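/- arXiv:1705.06749 — 4 statements merged into one kernel-verified Lean document; each statement's English description precedes it below -/
import Mathlib

section
/- Let A, B, C be finite-dimensional complex Hilbert spaces, let ρ_ABC be a density operator on A⊗B⊗C with marginal ρ_AB, and let R_{B→BC} be a trace-preserving completely positive map from operators on B to operators on B⊗C. Then I(A:C|B)_ρ ≤ D(ρ_ABC ‖ (id_A⊗R_{B→BC})(ρ_AB)) + inf over Markov chains μ_ABC (states with I(A:C|B)_μ = 0) of D_max( (id_A⊗R_{B→BC})(ρ_AB) ‖ μ_ABC ). -/
open scoped ComplexOrder

noncomputable section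

namespace QIT

variable {n : Type*} [Fintype n] [DecidableEq n]

/-- `x ↦ x·log₂ x` with the convention `0·log 0 = 0`. -/
def xlog (x : ℝ) : ℝ := if x = 0 then 0 else x * Real.logb 2 x

/-- Von Neumann entropy (base 2) of a matrix, via its eigenvalues. -/
def vN (ρ : Matrix n n ℂ) : ℝ :=
  if h : ρ.IsHermitian then -∑ i, xlog (h.eigenvalues i) else 0

/-- Matrix logarithm (base 2) via functional calculus on the support. -/
def matLog (ρ : Matrix n n ℂ) : Matrix n n ℂ :=
  if h : ρ.IsHermitian then
    (h.eigenvectorUnitary : Matrix n n ℂ) *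
      Matrix.diagonal (fun i =>
        ((if h.eigenvalues i = 0 then 0 else Real.logb 2 (h.eigenvalues i) : ℝ) : ℂ)) *
      (star (h.eigenvectorUnitary : Matrix n n ℂ))
  else 0

/-- Support inclusion: `supp ρ ⊆ supp σ` (for PSD matrices: `ker σ ⊆ ker ρ`). -/
def suppLe (ρ σ : Matrix n n ℂ) : Prop := ∀ v, σ.mulVec v = 0 → ρ.mulVec v = 0

open Classical in
/-- Umegaki relative entropy (base 2), `+∞` if the support condition fails. -/
def relEnt (ρ σ : Matrix n n ℂ) : EReal :=
  if suppLe ρ σ then (((ρ * (QIT.matLog ρ - QIT.matLog σ)).trace.re : ℝ) : EReal) else ⊤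

/-- Max-relative entropy `D_max(ρ‖σ) = inf{λ : ρ ≤ 2^λ σ}`, `+∞` if no such λ. -/
def dMax (ρ σ : Matrix n n ℂ) : EReal :=
  sInf {x : EReal | ∃ l : ℝ, x = (l : EReal) ∧ ((2 : ℝ) ^ l • σ - ρ).PosSemidef}

/-- Partial trace over the first tensor factor. -/
def ptrFst {α β : Type*} [Fintype α] (M : Matrix (α × β) (α × β) ℂ) : Matrix β β ℂ :=
  Matrix.of fun x y => ∑ i, M (i, x) (i, y)

/-- Partial trace over the second tensor factor. -/
def ptrSnd {α β : Type*} [Fintype β] (M : Matrix (α × β) (α × β) ℂ) : Matrix α α ℂ :=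
  Matrix.of fun x y => ∑ k, M (x, k) (y, k)

/-- Partial trace over the third factor of a tripartite system. -/
def ptrC3 {α β γ : Type*} [Fintype γ] (M : Matrix (α × β × γ) (α × β × γ) ℂ) :
    Matrix (α × β) (α × β) ℂ :=
  Matrix.of fun x y => ∑ k, M (x.1, x.2, k) (y.1, y.2, k)

/-- Conditional mutual information `I(A:C|B) = H(AB) + H(BC) - H(B) - H(ABC)`. -/
def cmi {α β γ : Type*} [Fintype α] [Fintype β] [Fintype γ]
    [DecidableEq α] [DecidableEq β] [DecidableEq γ]
    (ρ : Matrix (α × β × γ) (α × β × γ) ℂ) : ℝ :=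
  vN (ptrC3 ρ) + vN (ptrFst ρ) - vN (ptrSnd (ptrFst ρ)) - vN ρ

/-- Tensoring a map on the second factor with the identity on the first factor. -/
def tensorId {k b b' : Type*} (Φ : Matrix b b ℂ → Matrix b' b' ℂ)
    (M : Matrix (k × b) (k × b) ℂ) : Matrix (k × b') (k × b') ℂ :=
  Matrix.of fun x y => Φ (Matrix.of fun u v => M (x.1, u) (y.1, v)) x.2 y.2

/-- A quantum channel: linear, trace preserving and completely positive. -/
def IsCPTP {b b' : Type*} [Fintype b] [Fintype b']
    (Φ : Matrix b b ℂ →ₗ[ℂ] Matrix b' b' ℂ) : Prop :=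
  (∀ M, (Φ M).trace = M.trace) ∧
    ∀ (k : ℕ) (M : Matrix (Fin k × b) (Fin k × b) ℂ), M.PosSemidef →
      (tensorId (⇑Φ) M).PosSemidef

/-- `Λ_max(ρ_AB‖E)`: max-relative entropy distance from `ρ_AB` to the states
invariant under `id_A ⊗ E`. -/
def lambdaMax {a b : Type*} [Fintype a] [Fintype b]
    (ρ : Matrix (a × b) (a × b) ℂ) (E : Matrix b b ℂ → Matrix b b ℂ) : EReal :=
  ⨅ τ ∈ {τ : Matrix (a × b) (a × b) ℂ |
      τ.PosSemidef ∧ τ.trace = 1 ∧ tensorId E τ = τ}, dMax ρ τ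

end QIT


open Filter Topology in
/-- One-sided potential: limit at infinity. -/
theorem pot_limit {n : Type*} [Fintype n] (w : n → n → ℝ) (q p : n → ℝ)
    (hq : ∀ j, 0 ≤ q j) (hp : ∀ i, 0 ≤ p i) (hw1 : ∀ j, ∑ i, w i j = 1) :
    Tendsto (fun T : ℝ => (∑ i, ∑ j, w i j * q j * Real.log (p i + T * q j))
      - Real.log T * ∑ j, q j) atTop (𝓝 (∑ j, q j * Real.log (q j))) := by
  have e1 : ∑ j, q j * Real.log (q j) = ∑ i, ∑ j, w i j * q j * Real.log (q j) := by
    rw [Finset.sum_comm]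
    refine Finset.sum_congr rfl fun j _ => ?_
    simp_rw [mul_assoc]
    rw [← Finset.sum_mul, hw1, one_mul]
  have e2 : ∑ j, q j = ∑ i, ∑ j, w i j * q j := by
    rw [Finset.sum_comm]
    refine Finset.sum_congr rfl fun j _ => ?_
    rw [← Finset.sum_mul, hw1, one_mul]
  rw [e1, e2]
  have : (fun T : ℝ => ∑ i, ∑ j, w i j * q j * Real.log (p i * T⁻¹ + q j)) =ᶠ[atTop]
     (fun T : ℝ => (∑ i, ∑ j, w i j * q j * Real.log (p i + T * q j))
      - Real.log T * ∑ i, ∑ j, w i j * q j) := by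
    filter_upwards [eventually_gt_atTop 0] with T hT
    simp_rw [Finset.mul_sum, ← Finset.sum_sub_distrib]
    refine Finset.sum_congr rfl fun i _ => Finset.sum_congr rfl fun j _ => ?_
    rcases (hq j).eq_or_lt with h | h
    · simp [← h]
    · have h1 : p i + T * q j = T * (p i * T⁻¹ + q j) := by field_simp
      have h2 : 0 < p i * T⁻¹ + q j := by have := hp i; positivity
      rw [h1, Real.log_mul hT.ne' h2.ne']; ring
  refine Tendsto.congr' this ?_
  refine tendsto_finsetSum _ fun i _ => tendsto_finsetSum _ fun j _ => ?_
  rcases (hq j).eq_or_lt with h | h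
  · simp [← h]
  · refine Tendsto.const_mul _ ?_
    have h3 : Tendsto (fun T : ℝ => p i * T⁻¹ + q j) atTop (𝓝 (q j)) := by
      simpa using (tendsto_inv_atTop_zero.const_mul (p i)).add_const (q j)
    exact h3.log h.ne'

theorem pot_cont {n : Type*} [Fintype n] (w : n → n → ℝ) (q p : n → ℝ)
    (hq : ∀ j, 0 ≤ q j) (hp : ∀ i, 0 ≤ p i) (hz : ∀ i j, p i = 0 → w i j * q j = 0) :
    ContinuousOn (fun T : ℝ => (∑ i, ∑ j, w i j * q j * Real.log (p i + T * q j)))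
      (Set.Ici 0) := by
  refine continuousOn_finsetSum _ fun i _ => continuousOn_finsetSum _ fun j _ => ?_
  rcases (hp i).eq_or_lt with h | h
  · simp only [hz i j h.symm, zero_mul]; exact continuousOn_const
  · refine ContinuousOn.mul continuousOn_const (ContinuousOn.log (by fun_prop) ?_)
    intro T hT
    have := hq j
    have hT : 0 ≤ T := hT
    positivity

theorem pot_deriv {n : Type*} [Fintype n] (w : n → n → ℝ) (q p : n → ℝ)
    (hq : ∀ j, 0 ≤ q j) (hp : ∀ i, 0 ≤ p i) (T : ℝ) (hT : 0 < T) :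
    HasDerivAt (fun T : ℝ => (∑ i, ∑ j, w i j * q j * Real.log (p i + T * q j)))
      (∑ i, ∑ j, w i j * (q j ^ 2 / (p i + T * q j))) T := by
  refine HasDerivAt.fun_sum fun i _ => HasDerivAt.fun_sum fun j _ => ?_
  rcases (hq j).eq_or_lt with h | h
  · simpa [← h] using hasDerivAt_const T (0 : ℝ)
  · have h2 : 0 < p i + T * q j := by have := hp i; positivity
    have h3 : HasDerivAt (fun T : ℝ => p i + T * q j) (q j) T := by
      simpa using ((hasDerivAt_id T).mul_const (q j)).const_add (p i)
    have := (h3.log h2.ne').const_mul (w i j * q j)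
    refine this.congr_deriv ?_
    ring

open Filter Topology in
theorem scalar_core {n m : Type*} [Fintype n] [Fintype m]
    (w : n → n → ℝ) (q p : n → ℝ) (w' : m → m → ℝ) (q' p' : m → ℝ)
    (hq : ∀ j, 0 ≤ q j) (hp : ∀ i, 0 ≤ p i) (hw1 : ∀ j, ∑ i, w i j = 1)
    (hz : ∀ i j, p i = 0 → w i j * q j = 0)
    (hq' : ∀ j, 0 ≤ q' j) (hp' : ∀ i, 0 ≤ p' i) (hw1' : ∀ j, ∑ i, w' i j = 1)
    (hz' : ∀ i j, p' i = 0 → w' i j * q' j = 0)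
    (htr : ∑ j, q j = ∑ j, q' j)
    (hQ : ∀ s : ℝ, 0 < s → ∑ i, ∑ j, w' i j * (q' j ^ 2 / (p' i + s * q' j)) ≤
      ∑ i, ∑ j, w i j * (q j ^ 2 / (p i + s * q j))) :
    (∑ i, ∑ j, w i j * q j * Real.log (p i)) - (∑ i, ∑ j, w' i j * q' j * Real.log (p' i)) ≤
      (∑ j, q j * Real.log (q j)) - ∑ j, q' j * Real.log (q' j) := by
  set h : ℝ → ℝ := fun T => (∑ i, ∑ j, w i j * q j * Real.log (p i + T * q j)) -
    (∑ i, ∑ j, w' i j * q' j * Real.log (p' i + T * q' j)) with hh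
  have hd : ∀ T : ℝ, 0 < T → HasDerivAt h _ T := fun T hT =>
    (pot_deriv w q p hq hp T hT).sub (pot_deriv w' q' p' hq' hp' T hT)
  have hmono : MonotoneOn h (Set.Ici 0) := by
    refine monotoneOn_of_deriv_nonneg (convex_Ici 0)
      ((pot_cont w q p hq hp hz).sub (pot_cont w' q' p' hq' hp' hz')) ?_ ?_
    · intro T hT
      rw [interior_Ici] at hT
      exact (hd T hT).differentiableAt.differentiableWithinAt
    · intro T hT
      rw [interior_Ici] at hT
      rw [(hd T hT).deriv]
      exact sub_nonneg.2 (hQ T hT)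
  have hlim : Tendsto h atTop (𝓝 ((∑ j, q j * Real.log (q j)) - ∑ j, q' j * Real.log (q' j))) := by
    refine ((pot_limit w q p hq hp hw1).sub (pot_limit w' q' p' hq' hp' hw1')).congr fun T => ?_
    rw [htr, hh]; ring
  have h0 : (∑ i, ∑ j, w i j * q j * Real.log (p i)) -
      (∑ i, ∑ j, w' i j * q' j * Real.log (p' i)) = h 0 := by simp [hh]
  rw [h0]
  refine ge_of_tendsto hlim ?_
  filter_upwards [eventually_ge_atTop 0] with T hT
  exact hmono (Set.mem_Ici.2 le_rfl) hT hT

section Mat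
open Matrix QIT

/-- `V diag(f) V*`. -/
def spec {n : Type*} [Fintype n] [DecidableEq n] (V : Matrix n n ℂ) (f : n → ℝ) : Matrix n n ℂ :=
  V * diagonal (fun i => (f i : ℂ)) * Vᴴ

/-- overlap weights -/
def wt {n : Type*} [Fintype n] (U V : Matrix n n ℂ) (i j : n) : ℝ :=
  Complex.normSq ((Vᴴ * U) i j)

variable {n m : Type*} [Fintype n] [DecidableEq n] [Fintype m] [DecidableEq m]

theorem exists_spec (ρ : Matrix n n ℂ) (h : ρ.PosSemidef) :
    ∃ (U : Matrix n n ℂ) (q : n → ℝ), Uᴴ * U = 1 ∧ U * Uᴴ = 1 ∧ ρ = spec U q ∧ (∀ i, 0 ≤ q i) ∧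
      matLog ρ = spec U (fun i => Real.logb 2 (q i)) ∧
      vN ρ = - ∑ i, q i * Real.logb 2 (q i) := by
  refine ⟨h.1.eigenvectorUnitary, h.1.eigenvalues, ?_, ?_, ?_, h.eigenvalues_nonneg, ?_, ?_⟩
  · exact Unitary.coe_star_mul_self h.1.eigenvectorUnitary
  · exact Unitary.coe_mul_star_self h.1.eigenvectorUnitary
  · exact h.1.spectral_theorem
  · rw [matLog, dif_pos h.1, spec]
    congr 3
    ext i
    split_ifs with h0 <;> simp [h0]
  · rw [vN, dif_pos h.1]
    congr 1
    refine Finset.sum_congr rfl fun i _ => ?_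
    rw [xlog]
    split_ifs with h0 <;> simp [h0]

theorem trace_spec_spec (U V : Matrix n n ℂ) (q f : n → ℝ) :
    (spec U q * spec V f).trace.re = ∑ i, ∑ j, wt U V i j * q j * f i := by
  have h1 : (spec U q * spec V f).trace =
      ((Vᴴ * U) * diagonal (fun i => (q i : ℂ)) * (Vᴴ * U)ᴴ * diagonal (fun i => (f i : ℂ))).trace := by
    rw [spec, spec, conjTranspose_mul, conjTranspose_conjTranspose]
    have : U * diagonal (fun i => (q i : ℂ)) * Uᴴ * (V * diagonal (fun i => (f i : ℂ)) * Vᴴ) =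
      (U * diagonal (fun i => (q i : ℂ)) * Uᴴ * V * diagonal (fun i => (f i : ℂ))) * Vᴴ := by
      simp only [Matrix.mul_assoc]
    rw [this, trace_mul_comm]
    simp only [Matrix.mul_assoc]
  rw [h1, trace, Complex.re_sum]
  refine Finset.sum_congr rfl fun i _ => ?_
  rw [diag_apply, mul_diagonal, Matrix.mul_apply, Finset.sum_mul, Complex.re_sum]
  refine Finset.sum_congr rfl fun j _ => ?_
  rw [mul_diagonal, conjTranspose_apply, wt]
  set g := (Vᴴ * U) i j
  have : g * (q j : ℂ) * star g * (f i : ℂ) = ((Complex.normSq g * q j * f i : ℝ) : ℂ) := by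
    push_cast
    rw [← Complex.mul_conj]; simp only [Complex.star_def]; ring
  rw [this, Complex.ofReal_re]

theorem wt_sum (U V : Matrix n n ℂ) (hU : Uᴴ * U = 1) (hV : V * Vᴴ = 1) (j : n) :
    ∑ i, wt U V i j = 1 := by
  have h : (Vᴴ * U)ᴴ * (Vᴴ * U) = 1 := by
    rw [conjTranspose_mul, conjTranspose_conjTranspose, Matrix.mul_assoc, ← Matrix.mul_assoc V,
      hV, Matrix.one_mul, hU]
  have h2 := congrFun (congrFun h j) j
  rw [Matrix.mul_apply, one_apply_eq] at h2
  have h3 : ((∑ i, wt U V i j : ℝ) : ℂ) = 1 := by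
    rw [← h2]
    push_cast
    refine Finset.sum_congr rfl fun i _ => ?_
    rw [conjTranspose_apply, wt, Complex.normSq_eq_conj_mul_self]; rfl
  exact_mod_cast h3

theorem trace_spec_mul_self (U : Matrix n n ℂ) (q f : n → ℝ) (hU : Uᴴ * U = 1) :
    (spec U q * spec U f).trace.re = ∑ i, q i * f i := by
  rw [trace_spec_spec]
  refine Finset.sum_congr rfl fun i _ => ?_
  rw [Finset.sum_eq_single i]
  · simp [wt, hU]
  · intro b _ hb; simp [wt, hU, one_apply_ne hb.symm]
  · simp

theorem trace_spec (U : Matrix n n ℂ) (q : n → ℝ) (hU : Uᴴ * U = 1) :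
    (spec U q).trace = ∑ i, (q i : ℂ) := by
  rw [spec, trace_mul_comm, ← Matrix.mul_assoc, hU, Matrix.one_mul, trace_diagonal]

/-- The quadratic form in the variational formula. -/
def form (ρ σ : Matrix n n ℂ) (s : ℝ) (X : Matrix n n ℂ) : ℝ :=
  2 * (Xᴴ * ρ).trace.re - (Xᴴ * σ * X).trace.re - s * (X * ρ * Xᴴ).trace.re

theorem form_spec (U V : Matrix n n ℂ) (q p : n → ℝ) (hU : Uᴴ * U = 1) (hV : Vᴴ * V = 1)
    (s : ℝ) (Y : Matrix n n ℂ) :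
    form (spec U q) (spec V p) s (V * Y * Uᴴ) = ∑ i, ∑ j,
      (2 * (star (Y i j) * (Vᴴ * U) i j).re * q j - (p i + s * q j) * Complex.normSq (Y i j)) := by
  have a1 : ((V * Y * Uᴴ)ᴴ * spec U q).trace =
      (Yᴴ * ((Vᴴ * U) * diagonal (fun i => (q i : ℂ)))).trace := by
    rw [spec]
    simp only [conjTranspose_mul, conjTranspose_conjTranspose, ← Matrix.mul_assoc]
    rw [trace_mul_comm]
    simp only [← Matrix.mul_assoc, hU, Matrix.one_mul]
  have a2 : ((V * Y * Uᴴ)ᴴ * spec V p * (V * Y * Uᴴ)).trace =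
      (Yᴴ * (diagonal (fun i => (p i : ℂ)) * Y)).trace := by
    rw [spec]
    have : (V * Y * Uᴴ)ᴴ * (V * diagonal (fun i => (p i : ℂ)) * Vᴴ) * (V * Y * Uᴴ) =
      U * Yᴴ * (Vᴴ * V) * diagonal (fun i => (p i : ℂ)) * (Vᴴ * V) * Y * Uᴴ := by
      simp only [conjTranspose_mul, conjTranspose_conjTranspose, ← Matrix.mul_assoc]
    rw [this, trace_mul_comm, hV]
    simp only [← Matrix.mul_assoc, hU, Matrix.one_mul, Matrix.mul_one]
  have a3 : ((V * Y * Uᴴ) * spec U q * (V * Y * Uᴴ)ᴴ).trace =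
      (Yᴴ * (Y * diagonal (fun i => (q i : ℂ)))).trace := by
    rw [spec]
    have : (V * Y * Uᴴ) * (U * diagonal (fun i => (q i : ℂ)) * Uᴴ) * (V * Y * Uᴴ)ᴴ =
      V * (Y * (Uᴴ * U) * diagonal (fun i => (q i : ℂ)) * (Uᴴ * U) * Yᴴ * Vᴴ) := by
      simp only [conjTranspose_mul, conjTranspose_conjTranspose, ← Matrix.mul_assoc]
    rw [this, trace_mul_comm, hU]
    rw [trace_mul_comm Yᴴ]
    simp only [Matrix.mul_assoc, hV, Matrix.mul_one]
  have key : ∀ Z : Matrix n n ℂ, (Yᴴ * Z).trace.re = ∑ i, ∑ j, (star (Y i j) * Z i j).re := by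
    intro Z
    rw [trace, Complex.re_sum, Finset.sum_comm]
    refine Finset.sum_congr rfl fun i _ => ?_
    rw [diag_apply, Matrix.mul_apply, Complex.re_sum]
    rfl
  rw [form, a1, a2, a3, key, key, key]
  simp only [Finset.mul_sum, ← Finset.sum_sub_distrib]
  refine Finset.sum_congr rfl fun i _ => Finset.sum_congr rfl fun j _ => ?_
  rw [mul_diagonal, diagonal_mul, mul_diagonal]
  simp [Complex.normSq_apply]
  ring

theorem form_le (U V : Matrix n n ℂ) (q p : n → ℝ) (hU : Uᴴ * U = 1) (hV : Vᴴ * V = 1)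
    (hU2 : U * Uᴴ = 1) (hV2 : V * Vᴴ = 1)
    (hq : ∀ j, 0 ≤ q j) (hp : ∀ i, 0 ≤ p i) (s : ℝ) (hs : 0 < s) (X : Matrix n n ℂ) :
    form (spec U q) (spec V p) s X ≤ ∑ i, ∑ j, wt U V i j * (q j ^ 2 / (p i + s * q j)) := by
  have hX : X = V * (Vᴴ * X * U) * Uᴴ := by
    simp only [Matrix.mul_assoc, hU2, Matrix.mul_one]
    rw [← Matrix.mul_assoc, hV2, Matrix.one_mul]
  rw [hX, form_spec U V q p hU hV]
  refine Finset.sum_le_sum fun i _ => Finset.sum_le_sum fun j _ => ?_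
  set y := (Vᴴ * X * U) i j
  rw [wt]
  set g := (Vᴴ * U) i j
  have hpi := hp i
  rcases (hq j).eq_or_lt with h | h
  · have := mul_nonneg hpi (Complex.normSq_nonneg y)
    simp [← h]; exact this
  · have hk : 0 < p i + s * q j := by positivity
    set k := p i + s * q j
    have e : Complex.normSq g * (q j ^ 2 / k) - (2 * (star y * g).re * q j - k * Complex.normSq y)
      = ((k * y.re - q j * g.re) ^ 2 + (k * y.im - q j * g.im) ^ 2) / k := by
      field_simp
      simp [Complex.normSq_apply]; ring
    have : 0 ≤ ((k * y.re - q j * g.re) ^ 2 + (k * y.im - q j * g.im) ^ 2) / k := by positivity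
    linarith

theorem form_attained (U V : Matrix n n ℂ) (q p : n → ℝ) (hU : Uᴴ * U = 1) (hV : Vᴴ * V = 1)
    (hq : ∀ j, 0 ≤ q j) (hp : ∀ i, 0 ≤ p i) (s : ℝ) (hs : 0 < s) :
    ∃ X, form (spec U q) (spec V p) s X =
      ∑ i, ∑ j, wt U V i j * (q j ^ 2 / (p i + s * q j)) := by
  refine ⟨V * (of fun i j => ((q j / (p i + s * q j) : ℝ) : ℂ) * (Vᴴ * U) i j) * Uᴴ, ?_⟩
  rw [form_spec U V q p hU hV]
  refine Finset.sum_congr rfl fun i _ => Finset.sum_congr rfl fun j _ => ?_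
  rw [wt, of_apply]
  set g := (Vᴴ * U) i j
  have hpi := hp i
  rcases (hq j).eq_or_lt with h | h
  · simp [← h]
  · have hk : 0 < p i + s * q j := by positivity
    set k := p i + s * q j
    rw [Complex.normSq_mul, Complex.normSq_ofReal]
    have : (star (((q j / k : ℝ) : ℂ) * g) * g).re = q j / k * Complex.normSq g := by
      simp only [Complex.star_def, map_mul, Complex.conj_ofReal]
      rw [mul_assoc, ← Complex.normSq_eq_conj_mul_self, ← Complex.ofReal_mul, Complex.ofReal_re]
    rw [this]
    field_simp
    ring

theorem supp_wt (U V : Matrix n n ℂ) (q p : n → ℝ) (hU : Uᴴ * U = 1) (hV : Vᴴ * V = 1)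
    (hs : suppLe (spec U q) (spec V p)) (i j : n) (h : p i = 0) : wt U V i j * q j = 0 := by
  have h1 : (spec V p).mulVec (V.mulVec (Pi.single i 1)) = 0 := by
    rw [spec, mulVec_mulVec, Matrix.mul_assoc, hV, Matrix.mul_one, ← mulVec_mulVec]
    simp [h]
  have h2 := hs _ h1
  have h3 : (Uᴴ).mulVec ((spec U q).mulVec (V.mulVec (Pi.single i 1))) = 0 := by rw [h2]; simp
  have h4 : Uᴴ * spec U q * V = diagonal (fun i => (q i : ℂ)) * (Uᴴ * V) := by
    rw [spec]; simp only [← Matrix.mul_assoc, hU, Matrix.one_mul]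
  rw [mulVec_mulVec, mulVec_mulVec, h4] at h3
  have h5 := congrFun h3 j
  simp only [mulVec_single_one, Pi.zero_apply, col_apply, diagonal_mul] at h5
  have h6 : (Vᴴ * U) i j = star ((Uᴴ * V) j i) := by
    rw [← conjTranspose_apply, conjTranspose_mul, conjTranspose_conjTranspose]
  rcases mul_eq_zero.1 h5 with h7 | h7
  · simp [Complex.ofReal_eq_zero.1 h7]
  · simp [wt, h6, h7]

/-- Generalized monotonicity of relative entropy. -/
theorem core (ρ : Matrix n n ℂ) (hρ : ρ.PosSemidef) (ρ' : Matrix m m ℂ) (hρ' : ρ'.PosSemidef)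
    (V : Matrix n n ℂ) (p : n → ℝ) (V' : Matrix m m ℂ) (p' : m → ℝ)
    (hV : Vᴴ * V = 1) (hV2 : V * Vᴴ = 1) (hp : ∀ i, 0 ≤ p i)
    (hV' : V'ᴴ * V' = 1) (hV2' : V' * V'ᴴ = 1) (hp' : ∀ i, 0 ≤ p' i)
    (hs : suppLe ρ (spec V p)) (hs' : suppLe ρ' (spec V' p'))
    (φ : Matrix m m ℂ → Matrix n n ℂ) (htr : ρ.trace = ρ'.trace)
    (h1 : ∀ X, ((φ X)ᴴ * ρ).trace.re = (Xᴴ * ρ').trace.re)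
    (h2 : ∀ X, ((φ X)ᴴ * spec V p * φ X).trace.re ≤ (Xᴴ * spec V' p' * X).trace.re)
    (h3 : ∀ X, (φ X * ρ * (φ X)ᴴ).trace.re = (X * ρ' * Xᴴ).trace.re) :
    (ρ * spec V (fun i => Real.logb 2 (p i))).trace.re
      - (ρ' * spec V' (fun i => Real.logb 2 (p' i))).trace.re ≤ vN ρ' - vN ρ := by
  obtain ⟨U, q, hU, hU2, rfl, hq, -, hv⟩ := exists_spec ρ hρ
  obtain ⟨U', q', hU', hU2', rfl, hq', -, hv'⟩ := exists_spec ρ' hρ'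
  have htr' : ∑ j, q j = ∑ j, q' j := by
    rw [trace_spec _ _ hU, trace_spec _ _ hU'] at htr
    exact_mod_cast htr
  have := scalar_core (wt U V) q p (wt U' V') q' p' hq hp (wt_sum U V hU hV2)
    (supp_wt U V q p hU hV hs) hq' hp' (wt_sum U' V' hU' hV2') (supp_wt U' V' q' p' hU' hV' hs')
    htr' (by
      intro s hs
      obtain ⟨X, hX⟩ := form_attained U' V' q' p' hU' hV' hq' hp' s hs
      rw [← hX]
      refine le_trans ?_ (form_le U V q p hU hV hU2 hV2 hq hp s hs (φ X))
      rw [form, form, h1, h3]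
      linarith [h2 X])
  rw [trace_spec_spec, trace_spec_spec, hv, hv']
  simp only [Real.logb, mul_div_assoc', ← Finset.sum_div]
  have hl : 0 < Real.log 2 := Real.log_pos one_lt_two
  rw [← sub_div, neg_sub_neg, ← sub_div]
  gcongr

/-- `Tr (ρ log σ)`. -/
def trLog (ρ σ : Matrix n n ℂ) : ℝ := (ρ * matLog σ).trace.re

theorem trLog_self (ρ : Matrix n n ℂ) (h : ρ.PosSemidef) : trLog ρ ρ = - vN ρ := by
  obtain ⟨U, q, hU, hU2, e, hq, hl, hv⟩ := exists_spec ρ h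
  rw [trLog, hl, hv, neg_neg]
  conv_lhs => rw [e]
  exact trace_spec_mul_self U q _ hU

theorem trLog_sub (a b : ℝ) (ρ μ σ : Matrix n n ℂ) :
    trLog (a • μ - b • ρ) σ = a * trLog μ σ - b * trLog ρ σ := by
  simp [trLog, Matrix.sub_mul]

theorem suppLe_of_le (ρ σ : Matrix n n ℂ) (hρ : ρ.PosSemidef) (c : ℝ)
    (h : (c • σ - ρ).PosSemidef) : suppLe ρ σ := by
  intro v hv
  have h1 := h.dotProduct_mulVec_nonneg v
  have h2 := hρ.dotProduct_mulVec_nonneg v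
  rw [Matrix.sub_mulVec, Matrix.smul_mulVec, hv, smul_zero, zero_sub, dotProduct_neg] at h1
  exact (hρ.dotProduct_mulVec_zero_iff v).1 (le_antisymm (neg_nonneg.1 h1) h2)

theorem exists_le_smul_one (S : Matrix n n ℂ) (h : S.PosSemidef) :
    ∃ c : ℝ, 0 ≤ c ∧ (c • (1 : Matrix n n ℂ) - S).PosSemidef := by
  obtain ⟨U, q, hU, hU2, e, hq, -, -⟩ := exists_spec S h
  refine ⟨∑ i, q i, Finset.sum_nonneg fun i _ => hq i, ?_⟩
  have : (∑ i, q i) • (1 : Matrix n n ℂ) - S =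
      U * diagonal (fun j => (((∑ i, q i) - q j : ℝ) : ℂ)) * Uᴴ := by
    rw [e, spec]
    have : diagonal (fun j => (((∑ i, q i) - q j : ℝ) : ℂ)) =
      (∑ i, q i) • (1 : Matrix n n ℂ) - diagonal (fun j => (q j : ℂ)) := by
      ext i j
      by_cases hij : i = j
      · subst hij; simp
      · simp [hij]
    rw [this, Matrix.mul_sub, Matrix.sub_mul, Matrix.mul_smul, Matrix.smul_mul, Matrix.mul_one, hU2]
  rw [this]
  refine PosSemidef.mul_mul_conjTranspose_same (PosSemidef.diagonal ?_) U
  intro j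
  have : q j ≤ ∑ i, q i := Finset.single_le_sum (fun i _ => hq i) (Finset.mem_univ j)
  exact Complex.zero_le_real.2 (by linarith)

theorem exists_le (ρ σ : Matrix n n ℂ) (hρ : ρ.PosSemidef) (hσ : σ.PosSemidef)
    (hs : suppLe ρ σ) : ∃ c : ℝ, 0 ≤ c ∧ (c • σ - ρ).PosSemidef := by
  obtain ⟨V, p, hV, hV2, e, hp, -, -⟩ := exists_spec σ hσ
  set M : Matrix n n ℂ := V * diagonal (fun i => ((√(p i))⁻¹ : ℂ)) with hM
  set N : Matrix n n ℂ := diagonal (fun i => (√(p i) : ℂ)) * Vᴴ with hN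
  obtain ⟨c, hc, h⟩ := exists_le_smul_one (Mᴴ * ρ * M) (hρ.conjTranspose_mul_mul_same M)
  refine ⟨c, hc, ?_⟩
  have h2 := h.conjTranspose_mul_mul_same N
  have e1 : Nᴴ * N = σ := by
    rw [e, spec, hN, conjTranspose_mul, conjTranspose_conjTranspose, diagonal_conjTranspose]
    simp only [Matrix.mul_assoc]
    rw [← Matrix.mul_assoc (diagonal _) (diagonal _), diagonal_mul_diagonal]
    congr 3
    ext i
    simp only [Pi.star_apply, Complex.star_def, Complex.conj_ofReal]
    rw [← Complex.ofReal_mul, Real.mul_self_sqrt (hp i)]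
  have e2 : ρ * (M * N) = ρ := by
    have hk : ρ * V * diagonal (fun i => (if p i = 0 then 1 else 0 : ℂ)) = 0 := by
      ext a i
      rw [mul_diagonal]
      split_ifs with h0
      · have h1 : σ.mulVec (V.mulVec (Pi.single i 1)) = 0 := by
          rw [e, spec, mulVec_mulVec, Matrix.mul_assoc, hV, Matrix.mul_one, ← mulVec_mulVec]
          simp [h0]
        have h2 := congrFun (hs _ h1) a
        rw [mulVec_mulVec, mulVec_single_one] at h2
        simpa using h2
      · simp
    have e3 : M * N = V * (1 - diagonal (fun i => (if p i = 0 then 1 else 0 : ℂ))) * Vᴴ := by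
      rw [hM, hN]
      simp only [Matrix.mul_assoc]
      rw [← Matrix.mul_assoc (diagonal _) (diagonal _), diagonal_mul_diagonal]
      congr 2
      rw [← diagonal_one, diagonal_sub]
      congr 1
      ext i
      by_cases h0 : p i = 0
      · simp [h0]
      · have : (√(p i) : ℂ) ≠ 0 := by
          exact_mod_cast (Real.sqrt_pos.2 (lt_of_le_of_ne (hp i) (Ne.symm h0))).ne'
        simp [h0, this]
    rw [e3, ← Matrix.mul_assoc, ← Matrix.mul_assoc, Matrix.mul_sub, hk, Matrix.mul_one, sub_zero,
      Matrix.mul_assoc, hV2, Matrix.mul_one]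
  have e4 : (M * N)ᴴ * ρ = ρ := by
    have := congrArg conjTranspose e2
    rwa [conjTranspose_mul, hρ.1.eq] at this
  have e5 : Nᴴ * (c • (1 : Matrix n n ℂ) - Mᴴ * ρ * M) * N = c • σ - ρ := by
    rw [Matrix.mul_sub, Matrix.sub_mul, Matrix.mul_smul, Matrix.smul_mul, Matrix.mul_one, e1]
    congr 1
    have : Nᴴ * (Mᴴ * ρ * M) * N = (M * N)ᴴ * (ρ * (M * N)) := by
      rw [conjTranspose_mul M N]; simp only [Matrix.mul_assoc]
    rw [this, e2, e4]
  rwa [e5] at h2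

/-- `tr` is dual to the unital *-homomorphism `φ`. -/
structure IsMarg (φ : Matrix m m ℂ → Matrix n n ℂ) (tr : Matrix n n ℂ → Matrix m m ℂ) : Prop where
  map_one : φ 1 = 1
  map_mul : ∀ X Y, φ (X * Y) = φ X * φ Y
  map_star : ∀ X, φ Xᴴ = (φ X)ᴴ
  dual : ∀ X M, (φ X * M).trace = (X * tr M).trace

theorem IsMarg.trace {φ : Matrix m m ℂ → Matrix n n ℂ} {tr : Matrix n n ℂ → Matrix m m ℂ}
    (h : IsMarg φ tr) (M : Matrix n n ℂ) : M.trace = (tr M).trace := by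
  have := h.dual 1 M
  rwa [h.map_one, Matrix.one_mul, Matrix.one_mul] at this

theorem IsMarg.quad {φ : Matrix m m ℂ → Matrix n n ℂ} {tr : Matrix n n ℂ → Matrix m m ℂ}
    (h : IsMarg φ tr) (M : Matrix n n ℂ) (X : Matrix m m ℂ) :
    ((φ X)ᴴ * M * φ X).trace = (Xᴴ * tr M * X).trace := by
  rw [trace_mul_comm, ← Matrix.mul_assoc, ← h.map_star, ← h.map_mul, h.dual, Matrix.mul_assoc,
    trace_mul_comm]

theorem IsMarg.quad' {φ : Matrix m m ℂ → Matrix n n ℂ} {tr : Matrix n n ℂ → Matrix m m ℂ}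
    (h : IsMarg φ tr) (M : Matrix n n ℂ) (X : Matrix m m ℂ) :
    (φ X * M * (φ X)ᴴ).trace = (X * tr M * Xᴴ).trace := by
  have := h.quad M Xᴴ
  rwa [h.map_star, conjTranspose_conjTranspose, conjTranspose_conjTranspose] at this

theorem core_marg (ρ : Matrix n n ℂ) (hρ : ρ.PosSemidef)
    {φ : Matrix m m ℂ → Matrix n n ℂ} {tr : Matrix n n ℂ → Matrix m m ℂ} (hφ : IsMarg φ tr)
    (hρ' : (tr ρ).PosSemidef)
    (V : Matrix n n ℂ) (p : n → ℝ) (V' : Matrix m m ℂ) (p' : m → ℝ)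
    (hV : Vᴴ * V = 1) (hV2 : V * Vᴴ = 1) (hp : ∀ i, 0 ≤ p i)
    (hV' : V'ᴴ * V' = 1) (hV2' : V' * V'ᴴ = 1) (hp' : ∀ i, 0 ≤ p' i)
    (hs : suppLe ρ (spec V p)) (hs' : suppLe (tr ρ) (spec V' p'))
    (h2 : tr (spec V p) = spec V' p') :
    (ρ * spec V (fun i => Real.logb 2 (p i))).trace.re
      - (tr ρ * spec V' (fun i => Real.logb 2 (p' i))).trace.re ≤ vN (tr ρ) - vN ρ := by
  refine core ρ hρ (tr ρ) hρ' V p V' p' hV hV2 hp hV' hV2' hp' hs hs' φ (hφ.trace ρ) ?_ ?_ ?_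
  · intro X; rw [← hφ.map_star, hφ.dual]
  · intro X; rw [hφ.quad, h2]
  · intro X; rw [hφ.quad']

/-- Monotonicity of relative entropy. -/
theorem mono (ρ σ : Matrix n n ℂ) (hρ : ρ.PosSemidef) (hσ : σ.PosSemidef)
    {φ : Matrix m m ℂ → Matrix n n ℂ} {tr : Matrix n n ℂ → Matrix m m ℂ} (hφ : IsMarg φ tr)
    (hρ' : (tr ρ).PosSemidef) (hσ' : (tr σ).PosSemidef) (hs : suppLe ρ σ)
    (hs' : suppLe (tr ρ) (tr σ)) :
    trLog ρ σ - trLog (tr ρ) (tr σ) ≤ vN (tr ρ) - vN ρ := by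
  obtain ⟨V, p, hV, hV2, e, hp, hl, -⟩ := exists_spec σ hσ
  obtain ⟨V', p', hV', hV2', e', hp', hl', -⟩ := exists_spec (tr σ) hσ'
  rw [trLog, trLog, hl, hl']
  exact core_marg ρ hρ hφ hρ' V p V' p' hV hV2 hp hV' hV2' hp' (e ▸ hs) (e' ▸ hs') (by rw [← e, e'])

theorem anti (ρ σ μ : Matrix n n ℂ) (hρ : ρ.PosSemidef) (hσ : σ.PosSemidef) (hμ : μ.PosSemidef)
    (hs : suppLe ρ σ) (k : ℝ) (hk : 0 < k) (h : (k • μ - σ).PosSemidef) (htr : ρ.trace = 1) :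
    trLog ρ σ - trLog ρ μ ≤ Real.logb 2 k := by
  have hsμ : suppLe ρ μ := fun v hv => hs v (suppLe_of_le σ μ hσ k h v hv)
  obtain ⟨V, p, hV, hV2, e, hp, hl, -⟩ := exists_spec σ hσ
  obtain ⟨V', p', hV', hV2', e', hp', hl', -⟩ := exists_spec μ hμ
  have ek : spec V' (fun i => k * p' i) = k • μ := by
    rw [e', spec, spec, ← Matrix.smul_mul, ← Matrix.mul_smul]
    congr 2
    ext i j
    by_cases hij : i = j
    · subst hij; simp
    · simp [hij]
  have := core ρ hρ ρ hρ V p V' (fun i => k * p' i) hV hV2 hp hV' hV2'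
    (fun i => mul_nonneg hk.le (hp' i)) (e ▸ hs)
    (by
      rw [ek]
      intro v hv
      refine hsμ v ?_
      rw [Matrix.smul_mulVec] at hv
      exact (smul_eq_zero.1 hv).resolve_left hk.ne') id rfl (fun _ => rfl)
    (by
      intro X
      rw [ek, ← e]
      have := (h.conjTranspose_mul_mul_same X).trace_nonneg
      rw [Matrix.mul_sub, Matrix.sub_mul, trace_sub] at this
      have := (Complex.le_def.1 this).1
      simpa using this) (fun _ => rfl)
  rw [sub_self, ← hl] at this
  have e3 : (ρ * spec V' (fun i => Real.logb 2 (k * p' i))).trace.re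
      = Real.logb 2 k + trLog ρ μ := by
    rw [trLog, hl']
    obtain ⟨U, q, hU, hU2, eρ, hq, -, -⟩ := exists_spec ρ hρ
    have hz := supp_wt U V' q p' hU hV' (by rw [← eρ, ← e']; exact hsμ)
    have hsum : ∑ i, ∑ j, wt U V' i j * q j = 1 := by
      rw [Finset.sum_comm]
      have : ∀ j, ∑ i, wt U V' i j * q j = q j := fun j => by
        rw [← Finset.sum_mul, wt_sum U V' hU hV2', one_mul]
      simp_rw [this]
      rw [eρ, trace_spec _ _ hU] at htr
      exact_mod_cast htr
    rw [eρ, trace_spec_spec, trace_spec_spec]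
    rw [← mul_one (Real.logb 2 k), ← hsum]
    simp_rw [Finset.mul_sum, ← Finset.sum_add_distrib]
    refine Finset.sum_congr rfl fun i _ => Finset.sum_congr rfl fun j _ => ?_
    by_cases h0 : p' i = 0
    · simp [hz i j h0]
    · rw [Real.logb_mul hk.ne' h0]; ring
  rw [e3] at this
  rw [trLog]
  linarith

theorem klein (ρ σ : Matrix n n ℂ) (hρ : ρ.PosSemidef) (hσ : σ.PosSemidef)
    (hs : suppLe ρ σ) (htr : ρ.trace = σ.trace) : trLog ρ σ ≤ - vN ρ := by
  have hm : IsMarg (fun X : Matrix Unit Unit ℂ => X () () • (1 : Matrix n n ℂ))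
      (fun M => of fun _ _ => M.trace) := by
    refine ⟨by simp, ?_, ?_, ?_⟩
    · intro X Y; simp [Matrix.mul_apply, smul_smul, mul_comm]
    · intro X; simp
    · intro X M; simp [Matrix.mul_apply, Matrix.trace, Finset.mul_sum]
  have e : (of fun _ _ => ρ.trace : Matrix Unit Unit ℂ) = of fun _ _ => σ.trace := by rw [htr]
  have hp : ∀ M : Matrix n n ℂ, M.PosSemidef →
      (of fun _ _ => M.trace : Matrix Unit Unit ℂ).PosSemidef := by
    intro M hM
    have : (of fun _ _ => M.trace : Matrix Unit Unit ℂ) = diagonal fun _ => M.trace := by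
      ext i j; simp
    rw [this]
    exact PosSemidef.diagonal fun _ => hM.trace_nonneg
  have := mono ρ σ hρ hσ hm (hp ρ hρ) (hp σ hσ) hs (by simp only [e]; exact fun v hv => hv)
  simp only [← e] at this
  rw [trLog_self _ (hp ρ hρ)] at this
  linarith

end Mat

section Tri
open Matrix QIT
open scoped Kronecker

variable {A B C : Type*} [Fintype A] [Fintype B] [Fintype C]
    [DecidableEq A] [DecidableEq B] [DecidableEq C]

theorem psd_ptrFst (M : Matrix (A × B) (A × B) ℂ) (h : M.PosSemidef) : (ptrFst M).PosSemidef := by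
  have : ptrFst M = ∑ i, M.submatrix (fun x => (i, x)) (fun x => (i, x)) := by
    ext x y; simp [ptrFst, Matrix.sum_apply]
  rw [this]
  exact posSemidef_sum _ fun i _ => h.submatrix _

theorem psd_ptrC3 (M : Matrix (A × B × C) (A × B × C) ℂ) (h : M.PosSemidef) :
    (ptrC3 M).PosSemidef := by
  have : ptrC3 M = ∑ k, M.submatrix (fun x => (x.1, x.2, k)) (fun x => (x.1, x.2, k)) := by
    ext x y; simp [ptrC3, Matrix.sum_apply]
  rw [this]
  exact posSemidef_sum _ fun i _ => h.submatrix _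

theorem ptrFst_lin (a b : ℝ) (M N : Matrix (A × B) (A × B) ℂ) :
    ptrFst (a • M - b • N) = a • ptrFst M - b • ptrFst N := by
  ext x y; simp [ptrFst, Finset.mul_sum]

theorem ptrC3_lin (a b : ℝ) (M N : Matrix (A × B × C) (A × B × C) ℂ) :
    ptrC3 (a • M - b • N) = a • ptrC3 M - b • ptrC3 N := by
  ext x y; simp [ptrC3, Finset.mul_sum]

theorem ptr_comm (M : Matrix (A × B × C) (A × B × C) ℂ) :
    ptrSnd (ptrFst M) = ptrFst (ptrC3 M) := by
  ext x y
  simp only [ptrSnd, ptrFst, ptrC3, of_apply]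
  exact Finset.sum_comm

theorem marg_fst : IsMarg (fun X : Matrix B B ℂ => (1 : Matrix A A ℂ) ⊗ₖ X) ptrFst := by
  refine ⟨by simp, ?_, ?_, ?_⟩
  · intro X Y; rw [← mul_kronecker_mul, Matrix.one_mul]
  · intro X; rw [conjTranspose_kronecker, conjTranspose_one]
  · intro X M
    simp only [Matrix.trace, Matrix.diag_apply, Matrix.mul_apply, Fintype.sum_prod_type, ptrFst,
      of_apply, kroneckerMap_apply, Matrix.one_apply, ite_mul, one_mul, zero_mul]
    simp only [Finset.sum_ite_irrel, Finset.sum_const_zero, Finset.sum_ite_eq, Finset.mem_univ, if_true, Finset.mul_sum]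
    rw [Finset.sum_comm]
    refine Finset.sum_congr rfl fun x _ => ?_
    rw [Finset.sum_comm]

/-- `X_AB ⊗ 1_C` -/
def emb3 (X : Matrix (A × B) (A × B) ℂ) : Matrix (A × B × C) (A × B × C) ℂ :=
  (X ⊗ₖ (1 : Matrix C C ℂ)).submatrix (Equiv.prodAssoc A B C).symm (Equiv.prodAssoc A B C).symm

theorem marg_c3 : IsMarg (emb3 (A := A) (B := B) (C := C)) ptrC3 := by
  refine ⟨by simp [emb3], ?_, ?_, ?_⟩
  · intro X Y
    rw [emb3, emb3, emb3, submatrix_mul_equiv, ← mul_kronecker_mul, Matrix.one_mul]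
  · intro X; rw [emb3, emb3, conjTranspose_submatrix, conjTranspose_kronecker, conjTranspose_one]
  · intro X M
    simp only [Matrix.trace, Matrix.diag_apply, Matrix.mul_apply, Fintype.sum_prod_type, ptrC3,
      of_apply, emb3, submatrix_apply, Equiv.prodAssoc_symm_apply, kroneckerMap_apply,
      Matrix.one_apply, mul_ite, mul_one, mul_zero, ite_mul, zero_mul, Finset.sum_ite_eq, Finset.mem_univ, if_true, Finset.mul_sum]
    refine Finset.sum_congr rfl fun a _ => Finset.sum_congr rfl fun b _ => ?_
    rw [Finset.sum_comm]
    refine Finset.sum_congr rfl fun a' _ => ?_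
    rw [Finset.sum_comm]

theorem supp_one_kron (M : Matrix (A × B) (A × B) ℂ) (h : M.PosSemidef) :
    suppLe M ((1 : Matrix A A ℂ) ⊗ₖ ptrFst M) := by
  intro v hv
  set ev : A → A → (A × B → ℂ) := fun a a' x => if x.1 = a' then v (a, x.2) else 0 with hev
  have h0 : ∀ a, (ptrFst M).mulVec (fun b => v (a, b)) = 0 := by
    intro a
    ext b
    have := congrFun hv (a, b)
    simpa [mulVec, dotProduct, Fintype.sum_prod_type, Matrix.one_apply, Finset.sum_ite_irrel] using this
  have h1 : ∀ a, ∑ a', star (ev a a') ⬝ᵥ M.mulVec (ev a a') =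
      star (fun b => v (a, b)) ⬝ᵥ (ptrFst M).mulVec (fun b => v (a, b)) := by
    intro a
    simp only [hev, mulVec, dotProduct, Fintype.sum_prod_type, ptrFst, of_apply, Pi.star_apply,
      mul_ite, mul_zero, apply_ite star, star_zero, ite_mul, zero_mul, Finset.sum_ite_irrel,
      Finset.sum_const_zero, Finset.sum_ite_eq', Finset.mem_univ, if_true, Finset.mul_sum,
      Finset.sum_mul]
    rw [Finset.sum_comm]
    refine Finset.sum_congr rfl fun x _ => ?_
    rw [Finset.sum_comm]
  have h2 : ∀ a, M.mulVec (ev a a) = 0 := by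
    intro a
    have h3 := h1 a
    rw [h0, dotProduct_zero] at h3
    rw [Finset.sum_eq_zero_iff_of_nonneg (fun i _ => h.dotProduct_mulVec_nonneg _)] at h3
    exact (h.dotProduct_mulVec_zero_iff _).1 (h3 a (Finset.mem_univ a))
  have h4 : v = ∑ a, ev a a := by
    ext ⟨a, b⟩
    simp [hev]
  rw [h4, mulVec_sum]
  simp [h2]

theorem spec_kron (V : Matrix B B ℂ) (f : B → ℝ) :
    spec ((1 : Matrix A A ℂ) ⊗ₖ V) (fun i => f i.2) = (1 : Matrix A A ℂ) ⊗ₖ spec V f := by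
  have : (diagonal fun i : A × B => (f i.2 : ℂ)) = (1 : Matrix A A ℂ) ⊗ₖ diagonal fun i => (f i : ℂ) := by
    rw [← diagonal_one, diagonal_kronecker_diagonal]
    simp
  rw [spec, spec, this, conjTranspose_kronecker, conjTranspose_one, ← mul_kronecker_mul,
    ← mul_kronecker_mul, Matrix.one_mul, Matrix.one_mul]

theorem ptrC3_kron (N : Matrix (B × C) (B × C) ℂ) :
    ptrC3 ((1 : Matrix A A ℂ) ⊗ₖ N) = (1 : Matrix A A ℂ) ⊗ₖ ptrSnd N := by
  ext x y
  simp [ptrC3, ptrSnd, Finset.mul_sum]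

/-- Strong subadditivity. -/
theorem ssa (ν : Matrix (A × B × C) (A × B × C) ℂ) (hν : ν.PosSemidef) : 0 ≤ cmi ν := by
  have hBC := psd_ptrFst ν hν
  have hAB := psd_ptrC3 ν hν
  have hB := psd_ptrFst _ hAB
  obtain ⟨V, p, hV, hV2, e, hp, hl, -⟩ := exists_spec _ hBC
  obtain ⟨V', p', hV', hV2', e', hp', hl', -⟩ := exists_spec _ hB
  have := core_marg ν hν marg_c3 hAB ((1 : Matrix A A ℂ) ⊗ₖ V) (fun i => p i.2)
    ((1 : Matrix A A ℂ) ⊗ₖ V') (fun i => p' i.2)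
    (by rw [conjTranspose_kronecker, conjTranspose_one, ← mul_kronecker_mul, hV]; simp)
    (by rw [conjTranspose_kronecker, conjTranspose_one, ← mul_kronecker_mul, hV2]; simp)
    (fun i => hp i.2)
    (by rw [conjTranspose_kronecker, conjTranspose_one, ← mul_kronecker_mul, hV']; simp)
    (by rw [conjTranspose_kronecker, conjTranspose_one, ← mul_kronecker_mul, hV2']; simp)
    (fun i => hp' i.2)
    (by rw [spec_kron, ← e]; exact supp_one_kron ν hν)
    (by rw [spec_kron, ← e']; exact supp_one_kron _ hAB)
    (by rw [spec_kron, spec_kron, ptrC3_kron, ← e, ← e', ptr_comm])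
  rw [spec_kron V (fun i => Real.logb 2 (p i)), spec_kron V' (fun i => Real.logb 2 (p' i)), ← hl, ← hl',
    trace_mul_comm, marg_fst.dual, trace_mul_comm, trace_mul_comm (ptrC3 ν), marg_fst.dual,
    trace_mul_comm (matLog _)] at this
  have h1 := trLog_self _ hBC
  have h2 := trLog_self _ hB
  rw [trLog] at h1 h2
  rw [h1, h2] at this
  rw [cmi, ptr_comm]
  linarith

open Filter Topology in
theorem markov (ρ μ : Matrix (A × B × C) (A × B × C) ℂ) (hρ : ρ.PosSemidef) (hμ : μ.PosSemidef)
    (hρ1 : ρ.trace = 1) (hμ1 : μ.trace = 1) (hc : cmi μ = 0) (c : ℝ) (hc0 : 0 ≤ c)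
    (h : (c • μ - ρ).PosSemidef) :
    trLog ρ μ ≤ trLog (ptrC3 ρ) (ptrC3 μ) + trLog (ptrFst ρ) (ptrFst μ)
      - trLog (ptrFst (ptrC3 ρ)) (ptrFst (ptrC3 μ)) := by
  have hμBC := psd_ptrFst μ hμ
  have hμAB := psd_ptrC3 μ hμ
  have hμB := psd_ptrFst _ hμAB
  set Lf := trLog ρ μ - trLog (ptrC3 ρ) (ptrC3 μ) - trLog (ptrFst ρ) (ptrFst μ)
      + trLog (ptrFst (ptrC3 ρ)) (ptrFst (ptrC3 μ)) with hLf
  have key : ∀ ε : ℝ, 0 < ε → 0 < 1 + ε - ε * c →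
      Lf ≤ 2 * Real.logb 2 ((1 + ε - ε * c)⁻¹) := by
    intro ε hε hd
    set ν := (1 + ε) • μ - ε • ρ with hν
    have hνp : ν.PosSemidef := by
      have : ν = (1 + ε - ε * c) • μ + ε • (c • μ - ρ) := by
        rw [hν]; module
      rw [this]
      exact (hμ.smul hd.le).add (h.smul hε.le)
    have b1 : ((1 + ε) • μ - ν).PosSemidef := by
      have : (1 + ε) • μ - ν = ε • ρ := by rw [hν]; module
      rw [this]; exact hρ.smul hε.le
    set k := (1 + ε - ε * c)⁻¹ with hk
    have hk0 : 0 < k := inv_pos.2 hd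
    have b2 : (k • ν - μ).PosSemidef := by
      have hk1 : k * (1 + ε - ε * c) = 1 := inv_mul_cancel₀ hd.ne'
      have : k • ν - μ = (k * ε) • (c • μ - ρ) := by
        have e1 : k • ν - μ = k • ν - (k * (1 + ε - ε * c)) • μ := by rw [hk1, one_smul]
        rw [e1, hν]; module
      rw [this]; exact h.smul (by positivity)
    have ht : ∀ M N : Matrix (A × B × C) (A × B × C) ℂ, ∀ a b : ℝ, (a • M - b • N).trace = a * M.trace - b * N.trace := by
      intro M N a b; simp
    have hν1 : ν.trace = 1 := by rw [hν, ht, hρ1, hμ1]; push_cast; ring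
    have hνBC := psd_ptrFst ν hνp
    have hνAB := psd_ptrC3 ν hνp
    have hνB := psd_ptrFst _ hνAB
    have bAB : ((1 + ε) • ptrC3 μ - ptrC3 ν).PosSemidef := by
      have := psd_ptrC3 _ b1
      rw [← one_smul ℝ ν, ptrC3_lin, one_smul] at this; exact this
    have bBC : ((1 + ε) • ptrFst μ - ptrFst ν).PosSemidef := by
      have := psd_ptrFst _ b1
      rw [← one_smul ℝ ν, ptrFst_lin, one_smul] at this; exact this
    have bB : ((1 + ε) • ptrFst (ptrC3 μ) - ptrFst (ptrC3 ν)).PosSemidef := by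
      have := psd_ptrFst _ bAB
      rw [← one_smul ℝ (ptrC3 ν), ptrFst_lin, one_smul] at this; exact this
    have sν := suppLe_of_le ν μ hνp _ b1
    have sμ := suppLe_of_le μ ν hμ _ b2
    have sρ := suppLe_of_le ρ μ hρ _ h
    have sAB := suppLe_of_le _ _ hνAB _ bAB
    have sBC := suppLe_of_le _ _ hνBC _ bBC
    have sB := suppLe_of_le _ _ hνB _ bB
    have k1 := klein μ ν hμ hνp sμ (by rw [hμ1, hν1])
    have k2 := anti ρ μ ν hρ hμ hνp sρ k hk0 b2 hρ1
    have k3 := klein _ _ hνAB hμAB sAB (by rw [← marg_c3.trace, ← marg_c3.trace, hμ1, hν1])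
    have k4 := klein _ _ hνBC hμBC sBC (by rw [← marg_fst.trace, ← marg_fst.trace, hμ1, hν1])
    have k5 := mono ν μ hνp hμ marg_c3 hνAB hμAB sν sAB
    have k6 := mono _ _ hνAB hμAB marg_fst hνB hμB sAB sB
    have k7 := ssa ν hνp
    have s0 := trLog_self ν hνp
    have s1 := trLog_self μ hμ
    have s2 := trLog_self _ hμAB
    have s3 := trLog_self _ hμBC
    have s4 := trLog_self _ hμB
    have l1 : trLog ν ν = (1 + ε) * trLog μ ν - ε * trLog ρ ν := by
      conv_lhs => rw [show trLog ν ν = trLog ((1 + ε) • μ - ε • ρ) ν from rfl]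
      exact trLog_sub _ _ _ _ _
    have l2 : trLog ν μ = (1 + ε) * trLog μ μ - ε * trLog ρ μ := trLog_sub _ _ _ _ _
    have l3 : trLog (ptrC3 ν) (ptrC3 μ) = (1 + ε) * trLog (ptrC3 μ) (ptrC3 μ)
      - ε * trLog (ptrC3 ρ) (ptrC3 μ) := by rw [hν, ptrC3_lin, trLog_sub]
    have l4 : trLog (ptrFst ν) (ptrFst μ) = (1 + ε) * trLog (ptrFst μ) (ptrFst μ)
      - ε * trLog (ptrFst ρ) (ptrFst μ) := by rw [hν, ptrFst_lin, trLog_sub]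
    have l5 : trLog (ptrFst (ptrC3 ν)) (ptrFst (ptrC3 μ)) =
      (1 + ε) * trLog (ptrFst (ptrC3 μ)) (ptrFst (ptrC3 μ))
      - ε * trLog (ptrFst (ptrC3 ρ)) (ptrFst (ptrC3 μ)) := by
      rw [hν, ptrC3_lin, ptrFst_lin, trLog_sub]
    rw [cmi, ptr_comm] at k7 hc
    -- relative entropy of `ν` and `μ` is `O(ε log k)`
    have d1 : trLog ν ν - trLog ν μ ≤ ε * Real.logb 2 k := by
      rw [l1, l2]
      have q1 : (1 + ε) * (trLog μ ν - trLog μ μ) ≤ 0 :=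
        mul_nonpos_of_nonneg_of_nonpos (by positivity) (by linarith)
      have q2 := mul_le_mul_of_nonneg_left k2 hε.le
      linarith
    have d2 : - vN (ptrFst (ptrC3 ν)) - trLog (ptrFst (ptrC3 ν)) (ptrFst (ptrC3 μ)) ≤
      ε * Real.logb 2 k := by linarith
    have d3 : ε * Lf ≤ ε * (2 * Real.logb 2 k) := by
      have z : (1 + ε) * (trLog μ μ - trLog (ptrC3 μ) (ptrC3 μ) - trLog (ptrFst μ) (ptrFst μ)
        + trLog (ptrFst (ptrC3 μ)) (ptrFst (ptrC3 μ))) = 0 := by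
        rw [s1, s2, s3, s4]
        have : (-vN μ - -vN (ptrC3 μ) - -vN (ptrFst μ) + -vN (ptrFst (ptrC3 μ))) = 0 := by linarith
        rw [this, mul_zero]
      have z2 : ε * Lf = -(trLog ν μ - trLog (ptrC3 ν) (ptrC3 μ) - trLog (ptrFst ν) (ptrFst μ)
        + trLog (ptrFst (ptrC3 ν)) (ptrFst (ptrC3 μ))) := by
        rw [l2, l3, l4, l5, hLf]; linarith
      rw [z2]
      linarith
    exact le_of_mul_le_mul_left d3 hε
  have lim : Tendsto (fun ε : ℝ => 2 * Real.logb 2 ((1 + ε - ε * c)⁻¹)) (𝓝[>] 0) (𝓝 0) := by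
    have hcont : ContinuousAt (fun ε : ℝ => 2 * (Real.log ((1 + ε - ε * c)⁻¹) / Real.log 2)) 0 := by
      refine ContinuousAt.mul continuousAt_const (ContinuousAt.div_const (ContinuousAt.log ?_ ?_) _)
      · refine ContinuousAt.inv₀ (by fun_prop) (by simp)
      · simp
    have := hcont.tendsto
    simp only [zero_mul, add_zero, sub_zero, inv_one, Real.log_one, zero_div, mul_zero] at this
    exact this.mono_left nhdsWithin_le_nhds
  have hL0 : Lf ≤ 0 := by
    refine ge_of_tendsto lim ?_
    have hpos : ∀ᶠ ε : ℝ in 𝓝 0, 0 < 1 + ε - ε * c := by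
      have : ContinuousAt (fun ε : ℝ => 1 + ε - ε * c) 0 := by fun_prop
      exact this.eventually_const_lt (by simp)
    filter_upwards [self_mem_nhdsWithin, nhdsWithin_le_nhds hpos] with ε h1 h2
    exact key ε h1 h2
  linarith

theorem psd_tensorId (R : Matrix B B ℂ →ₗ[ℂ] Matrix (B × C) (B × C) ℂ) (hR : IsCPTP R)
    (M : Matrix (A × B) (A × B) ℂ) (hM : M.PosSemidef) : (tensorId (⇑R) M).PosSemidef := by
  let e := Fintype.equivFin A
  have h1 := hR.2 (Fintype.card A) (M.submatrix (fun x => (e.symm x.1, x.2)) (fun x => (e.symm x.1, x.2)))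
    (hM.submatrix _)
  have h2 := h1.submatrix (fun x : A × (B × C) => (e x.1, x.2))
  convert h2 using 1
  ext x y
  simp [tensorId]

theorem trace_tensorId (R : Matrix B B ℂ →ₗ[ℂ] Matrix (B × C) (B × C) ℂ) (hR : IsCPTP R)
    (M : Matrix (A × B) (A × B) ℂ) : (tensorId (⇑R) M).trace = M.trace := by
  rw [Matrix.trace, Fintype.sum_prod_type, Matrix.trace, Fintype.sum_prod_type]
  refine Finset.sum_congr rfl fun a _ => ?_
  have := hR.1 (of fun u v => M (a, u) (a, v))
  simpa [Matrix.trace, tensorId] using this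

end Tri

open QIT in
/-- `I(A:C|B)_ρ ≤ D(ρ_ABC ‖ (id_A⊗R)(ρ_AB)) +
inf over Markov chains μ of D_max((id_A⊗R)(ρ_AB) ‖ μ)`. -/
theorem cmi_le_relEnt_add_inf_dMax {A B C : Type*} [Fintype A] [Fintype B] [Fintype C]
    [DecidableEq A] [DecidableEq B] [DecidableEq C]
    (ρ : Matrix (A × B × C) (A × B × C) ℂ) (hρ : ρ.PosSemidef) (hρ1 : ρ.trace = 1)
    (R : Matrix B B ℂ →ₗ[ℂ] Matrix (B × C) (B × C) ℂ) (hR : IsCPTP R) :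
    ((cmi ρ : ℝ) : EReal) ≤
      relEnt ρ (tensorId (⇑R) (ptrC3 ρ)) +
        ⨅ μ ∈ {μ : Matrix (A × B × C) (A × B × C) ℂ |
            μ.PosSemidef ∧ μ.trace = 1 ∧ cmi μ = 0}, dMax (tensorId (⇑R) (ptrC3 ρ)) μ := by
  classical
  set σ := tensorId (⇑R) (ptrC3 ρ) with hσdef
  have hσ : σ.PosSemidef := psd_tensorId R hR _ (psd_ptrC3 ρ hρ)
  have hσ1 : σ.trace = 1 := by rw [hσdef, trace_tensorId R hR, ← marg_c3.trace, hρ1]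
  by_cases hs : suppLe ρ σ
  · have hD : relEnt ρ σ = ((- vN ρ - trLog ρ σ : ℝ) : EReal) := by
      rw [relEnt, if_pos hs, ← trLog_self ρ hρ, trLog, trLog, Matrix.mul_sub, Matrix.trace_sub,
        Complex.sub_re]
    rw [hD, add_comm, ← EReal.sub_le_iff_le_add (Or.inl (EReal.coe_ne_bot _)) (Or.inl (EReal.coe_ne_top _))]
    refine le_iInf₂ fun μ hμ => le_sInf ?_
    rintro x ⟨l, rfl, hl⟩
    obtain ⟨hμp, hμ1, hμc⟩ := hμ
    rw [← EReal.coe_sub, EReal.coe_le_coe_iff]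
    have hk : (0 : ℝ) < 2 ^ l := by positivity
    have h1 := anti ρ σ μ hρ hσ hμp hs _ hk hl hρ1
    rw [Real.logb_rpow (by norm_num) (by norm_num)] at h1
    have hsμ : suppLe ρ μ := fun v hv => hs v (suppLe_of_le σ μ hσ _ hl v hv)
    obtain ⟨c, hc0, hc⟩ := exists_le ρ μ hρ hμp hsμ
    have h2 := markov ρ μ hρ hμp hρ1 hμ1 hμc c hc0 hc
    have bAB : (c • ptrC3 μ - ptrC3 ρ).PosSemidef := by
      have := psd_ptrC3 _ hc
      rw [← one_smul ℝ ρ, ptrC3_lin, one_smul] at this; exact this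
    have bBC : (c • ptrFst μ - ptrFst ρ).PosSemidef := by
      have := psd_ptrFst _ hc
      rw [← one_smul ℝ ρ, ptrFst_lin, one_smul] at this; exact this
    have bB : (c • ptrFst (ptrC3 μ) - ptrFst (ptrC3 ρ)).PosSemidef := by
      have := psd_ptrFst _ bAB
      rw [← one_smul ℝ (ptrC3 ρ), ptrFst_lin, one_smul] at this; exact this
    have pAB := psd_ptrC3 ρ hρ
    have pBC := psd_ptrFst ρ hρ
    have pB := psd_ptrFst _ pAB
    have mAB := psd_ptrC3 μ hμp
    have mBC := psd_ptrFst μ hμp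
    have mB := psd_ptrFst _ mAB
    have h3 := mono _ _ pAB mAB marg_fst pB mB (suppLe_of_le _ _ pAB _ bAB)
      (suppLe_of_le _ _ pB _ bB)
    have h4 := klein _ _ pBC mBC (suppLe_of_le _ _ pBC _ bBC)
      (by rw [← marg_fst.trace, ← marg_fst.trace, hρ1, hμ1])
    rw [cmi, ptr_comm]
    linarith
  · have hD : relEnt ρ σ = ⊤ := by rw [relEnt, if_neg hs]
    have h0 : (0 : EReal) ≤ ⨅ μ ∈ {μ : Matrix (A × B × C) (A × B × C) ℂ |
            μ.PosSemidef ∧ μ.trace = 1 ∧ cmi μ = 0}, dMax σ μ := by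
      refine le_iInf₂ fun μ hμ => le_sInf ?_
      rintro x ⟨l, rfl, hl⟩
      obtain ⟨hμp, hμ1, hμc⟩ := hμ
      have h1 := hl.trace_nonneg
      rw [Matrix.trace_sub, Matrix.trace_smul, hμ1, hσ1] at h1
      have h2 := (Complex.le_def.1 h1).1
      simp only [Complex.sub_re, Complex.smul_re, Complex.one_re, Complex.zero_re, smul_eq_mul,
        mul_one, sub_nonneg] at h2
      have h3 : 0 ≤ l := by
        by_contra hneg
        exact absurd h2 (not_le.2 (Real.rpow_lt_one_of_one_lt_of_neg one_lt_two (not_le.1 hneg)))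
      exact_mod_cast h3
    rw [hD, EReal.top_add_of_ne_bot (ne_of_gt (lt_of_lt_of_le (by simp) h0))]
    exact le_top
end
end

section
/- Let A, B, C be finite-dimensional complex Hilbert spaces, let ρ_AB be a density operator on A⊗B, and let R_{B→BC} be a trace-preserving completely positive map from operators on B to operators on B⊗C whose marginal channel R_{B→B} := Tr_C ∘ R_{B→BC} satisfies (id_A⊗R_{B→B})(ρ_AB) = ρ_AB (the recovery map is 'read only' on B). Then the output state σ_ABC := (id_A⊗R_{B→BC})(ρ_AB) is a Markov chain A↔B↔C, i.e., I(A:C|B)_σ = 0. -/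
open scoped ComplexOrder

noncomputable section

set_option linter.unusedSectionVars false

namespace QIT
open Matrix

/-- Hermitian functional calculus attached to a unitary. -/
def fnU {n : Type*} [Fintype n] [DecidableEq n] (U : Matrix n n ℂ) (g : n → ℝ) : Matrix n n ℂ :=
  U * Matrix.diagonal (fun i => (g i : ℂ)) * Uᴴ


section spectral
variable {n : Type*} [Fintype n] [DecidableEq n]

lemma fnU_mul {U : Matrix n n ℂ} (hU : Uᴴ * U = 1) (f g : n → ℝ) :
    fnU U f * fnU U g = fnU U (fun i => f i * g i) := by
  unfold fnU
  calc _ = U * diagonal (fun i => (f i : ℂ)) * (Uᴴ * U) * diagonal (fun i => (g i : ℂ)) * Uᴴ := by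
        simp only [Matrix.mul_assoc]
    _ = _ := by
        rw [hU, Matrix.mul_one, Matrix.mul_assoc U, Matrix.diagonal_mul_diagonal]
        simp

lemma fnU_one {U : Matrix n n ℂ} (hU : Uᴴ * U = 1) : fnU U (fun _ => 1) = 1 := by
  unfold fnU
  have : diagonal (fun _ : n => ((1 : ℝ) : ℂ)) = 1 := by simp
  rw [this, Matrix.mul_one]
  exact mul_eq_one_comm.mp hU

lemma fnU_pow {U : Matrix n n ℂ} (hU : Uᴴ * U = 1) (f : n → ℝ) (k : ℕ) :
    fnU U f ^ k = fnU U (fun i => f i ^ k) := by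
  induction k with
  | zero => simp [fnU_one hU]
  | succ k ih => rw [pow_succ, ih, fnU_mul hU]; simp [pow_succ]

lemma fnU_herm (U : Matrix n n ℂ) (f : n → ℝ) : (fnU U f)ᴴ = fnU U f := by
  unfold fnU
  rw [conjTranspose_mul, conjTranspose_mul, conjTranspose_conjTranspose, diagonal_conjTranspose,
    Matrix.mul_assoc]
  congr 3
  ext i
  simp

lemma fnU_trace (U V : Matrix n n ℂ) (f g : n → ℝ) :
    (fnU U f * fnU V g).trace =
      ((∑ i, ∑ j, f i * g j * Complex.normSq ((Uᴴ * V) i j) : ℝ) : ℂ) := by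
  unfold fnU
  have h1 : (U * diagonal (fun i => (f i : ℂ)) * Uᴴ * (V * diagonal (fun i => (g i : ℂ)) * Vᴴ)).trace
      = (diagonal (fun i => (f i : ℂ)) * (Uᴴ * V) * diagonal (fun i => (g i : ℂ)) * (Uᴴ * V)ᴴ).trace := by
    rw [conjTranspose_mul, conjTranspose_conjTranspose]
    simp only [Matrix.mul_assoc]
    rw [Matrix.trace_mul_comm U]
    simp only [Matrix.mul_assoc]
  rw [h1]
  generalize Uᴴ * V = W
  simp only [Matrix.trace, Matrix.diag]
  push_cast
  refine Finset.sum_congr rfl fun i _ => ?_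
  rw [Matrix.mul_apply]
  refine Finset.sum_congr rfl fun j _ => ?_
  rw [Matrix.mul_diagonal, Matrix.diagonal_mul, conjTranspose_apply, Complex.normSq_eq_conj_mul_self]
  simp only [RCLike.star_def]
  ring

lemma interp {ι κ : Type*} [Fintype ι] [Fintype κ] (c x : ι → ℝ) (d y : κ → ℝ)
    (h : ∀ k : ℕ, ∑ i, c i * x i ^ k = ∑ j, d j * y j ^ k) (g : ℝ → ℝ) :
    ∑ i, c i * g (x i) = ∑ j, d j * g (y j) := by
  classical
  let s : Finset ℝ := Finset.univ.image x ∪ Finset.univ.image y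
  let p := Lagrange.interpolate s id g
  have hp : ∀ t ∈ s, p.eval t = g t := fun t ht =>
    Lagrange.eval_interpolate_at_node (v := id) g (Function.injective_id.injOn) ht
  have hx : ∀ i, g (x i) = p.eval (x i) := fun i => (hp _ (by simp [s])).symm
  have hy : ∀ i, g (y i) = p.eval (y i) := fun i => (hp _ (by simp [s])).symm
  simp only [hx, hy, Polynomial.eval_eq_sum_range, Finset.mul_sum]
  rw [Finset.sum_comm, Finset.sum_comm (s := Finset.univ (α := κ))]
  refine Finset.sum_congr rfl fun k _ => ?_
  have := congrArg (fun t => p.coeff k * t) (h k)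
  simp only [Finset.mul_sum] at this
  calc _ = _ := Finset.sum_congr rfl fun i _ => by ring
    _ = _ := this
    _ = _ := Finset.sum_congr rfl fun i _ => by ring

/-- Relative-entropy-like expression via powers. -/
lemma relent_sum {U V : Matrix n n ℂ} (hU : Uᴴ * U = 1) (hV : Vᴴ * V = 1) (f g : n → ℝ)
    (hs : fnU U f * (fnU V g * fnU V (fun j => (g j)⁻¹)) = fnU U f) :
    ∑ p : n × n, (f p.1 * Complex.normSq ((Uᴴ * V) p.1 p.2)) *
        Real.logb 2 (f p.1 * (g p.2)⁻¹) =
      ∑ i, f i * Real.logb 2 (f i) - (fnU U f * fnU V (fun j => Real.logb 2 (g j))).trace.re := by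
  have key : ∀ i j, g j = 0 → f i * Complex.normSq ((Uᴴ * V) i j) = 0 := by
    intro i j hg
    rw [fnU_mul hV] at hs
    have h2 : Uᴴ * fnU U f * V = diagonal (fun i => (f i : ℂ)) * (Uᴴ * V) := by
      unfold fnU
      rw [← Matrix.mul_assoc, ← Matrix.mul_assoc, hU, Matrix.one_mul, Matrix.mul_assoc]
    have h3 : Uᴴ * (fnU U f * fnU V (fun j => g j * (g j)⁻¹)) * V =
        diagonal (fun i => (f i : ℂ)) * (Uᴴ * V) * diagonal (fun j => ((g j * (g j)⁻¹ : ℝ) : ℂ)) := by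
      rw [← h2]
      unfold fnU
      simp only [Matrix.mul_assoc, hV, Matrix.mul_one]
    rw [hs, h2] at h3
    have h4 := congrFun (congrFun h3 i) j
    rw [Matrix.mul_diagonal, Matrix.diagonal_mul, hg] at h4
    simp only [mul_zero, Complex.ofReal_zero, zero_mul, mul_eq_zero, Complex.ofReal_eq_zero] at h4
    rcases h4 with h4 | h4
    · simp [h4]
    · simp [h4]
  have rowsum : ∀ i, ∑ j, Complex.normSq ((Uᴴ * V) i j) = 1 := by
    intro i
    have hW : (Uᴴ * V) * (Uᴴ * V)ᴴ = 1 := by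
      rw [conjTranspose_mul, conjTranspose_conjTranspose]
      rw [Matrix.mul_assoc, ← Matrix.mul_assoc V, mul_eq_one_comm.mp hV, Matrix.one_mul, hU]
    have := congrFun (congrFun hW i) i
    rw [Matrix.mul_apply, Matrix.one_apply_eq] at this
    have h5 : ((∑ j, Complex.normSq ((Uᴴ * V) i j) : ℝ) : ℂ) = 1 := by
      rw [← this]
      push_cast
      refine Finset.sum_congr rfl fun j _ => ?_
      rw [conjTranspose_apply, Complex.normSq_eq_conj_mul_self, RCLike.star_def, mul_comm]
    exact_mod_cast h5
  rw [fnU_trace, Complex.ofReal_re, Fintype.sum_prod_type, ← Finset.sum_sub_distrib]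
  refine Finset.sum_congr rfl fun i _ => ?_
  have : f i * Real.logb 2 (f i) = ∑ j, f i * Real.logb 2 (f i) * Complex.normSq ((Uᴴ * V) i j) := by
    rw [← Finset.mul_sum, rowsum, mul_one]
  rw [this, ← Finset.sum_sub_distrib]
  refine Finset.sum_congr rfl fun j _ => ?_
  by_cases hf : f i = 0
  · simp [hf]
  by_cases hg : g j = 0
  · have := key i j hg
    rcases mul_eq_zero.mp this with h | h
    · exact absurd h hf
    · simp [h]
  · simp only
    rw [Real.logb_mul hf (inv_ne_zero hg), Real.logb_inv]
    ring

lemma relent_pow {U V : Matrix n n ℂ} (hU : Uᴴ * U = 1) (hV : Vᴴ * V = 1) (f g : n → ℝ) (k : ℕ) :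
    (fnU U f ^ (k + 1) * fnU V (fun j => (g j)⁻¹) ^ k).trace =
    ((∑ p : n × n, (f p.1 * Complex.normSq ((Uᴴ * V) p.1 p.2)) * (f p.1 * (g p.2)⁻¹) ^ k : ℝ) : ℂ) := by
  rw [fnU_pow hU, fnU_pow hV, fnU_trace, Fintype.sum_prod_type]
  congr 1
  refine Finset.sum_congr rfl fun i _ => Finset.sum_congr rfl fun j _ => ?_
  simp only
  rw [mul_pow]; ring

end spectral

lemma spec {n : Type*} [Fintype n] [DecidableEq n] {M : Matrix n n ℂ} (h : M.IsHermitian) :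
    M = fnU (h.eigenvectorUnitary : Matrix n n ℂ) h.eigenvalues := by
  conv_lhs => rw [h.spectral_theorem, Unitary.conjStarAlgAut_apply]
  rfl

lemma spec_unit {n : Type*} [Fintype n] [DecidableEq n] {M : Matrix n n ℂ} (h : M.IsHermitian) :
    (h.eigenvectorUnitary : Matrix n n ℂ)ᴴ * (h.eigenvectorUnitary : Matrix n n ℂ) = 1 :=
  Unitary.coe_star_mul_self h.eigenvectorUnitary

lemma psd_factor {n : Type*} [Fintype n] [DecidableEq n] {M : Matrix n n ℂ} (h : M.PosSemidef) :
    ∃ S : Matrix n n ℂ, M = Sᴴ * S := by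
  refine ⟨fnU (h.1.eigenvectorUnitary : Matrix n n ℂ) (fun i => √(h.1.eigenvalues i)), ?_⟩
  rw [fnU_herm, fnU_mul (spec_unit h.1)]
  conv_lhs => rw [spec h.1]
  congr 1
  ext i
  exact (Real.mul_self_sqrt (h.eigenvalues_nonneg i)).symm

section psd
variable {n m : Type*} [Fintype n] [DecidableEq n] [Fintype m] [DecidableEq m]

lemma mul_eq_zero_of_trace {ι : Type*} [Fintype ι] {ρ : Matrix n n ℂ} (hρ : ρ.PosSemidef)
    (D : ι → Matrix m n ℂ) (h : ∑ i, (D i * ρ * (D i)ᴴ).trace = 0) (i : ι) : D i * ρ = 0 := by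
  have hp : ∀ i, (D i * ρ * (D i)ᴴ).PosSemidef := fun i => hρ.mul_mul_conjTranspose_same (D i)
  have h0 : (D i * ρ * (D i)ᴴ).trace = 0 :=
    (Finset.sum_eq_zero_iff_of_nonneg (fun i _ => (hp i).trace_nonneg)).mp h i (Finset.mem_univ i)
  have h1 : D i * ρ * (D i)ᴴ = 0 := (hp i).trace_eq_zero_iff.mp h0
  obtain ⟨S, hS⟩ := psd_factor hρ
  rw [hS] at h1 ⊢
  have h2 : (D i * Sᴴ) * (D i * Sᴴ)ᴴ = 0 := by
    rw [conjTranspose_mul, conjTranspose_conjTranspose, ← h1]; simp only [Matrix.mul_assoc]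
  rw [Matrix.self_mul_conjTranspose_eq_zero] at h2
  rw [← Matrix.mul_assoc, h2, Matrix.zero_mul]

end psd

section core
variable {D O ι : Type*} [Fintype D] [DecidableEq D] [Fintype O] [DecidableEq O] [Fintype ι]

/-- Kraus map. -/
def kr (T : ι → Matrix O D ℂ) (X : Matrix D D ℂ) : Matrix O O ℂ := ∑ i, T i * X * (T i)ᴴ

/-- `X` is preserved by the marginal channel, in weak form. -/
def Fixd (T : ι → Matrix O D ℂ) (π : Matrix D D ℂ → Matrix O O ℂ) (X : Matrix D D ℂ) : Prop :=
  ∀ y, (π y * kr T X).trace = (y * X).trace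

/-- intertwining on the support of `ρ`. -/
def Gd (T : ι → Matrix O D ℂ) (π : Matrix D D ℂ → Matrix O O ℂ) (ρ y : Matrix D D ℂ) : Prop :=
  ∀ i, π y * T i * ρ = T i * y * ρ

structure Hom (T : ι → Matrix O D ℂ) (π : Matrix D D ℂ → Matrix O O ℂ) : Prop where
  mul : ∀ x y, π (x * y) = π x * π y
  one : π 1 = 1
  star : ∀ x, π xᴴ = (π x)ᴴ
  iso : ∑ i, (T i)ᴴ * T i = 1

variable {T : ι → Matrix O D ℂ} {π : Matrix D D ℂ → Matrix O O ℂ}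

lemma kr_herm (X : Matrix D D ℂ) : (kr T X)ᴴ = kr T Xᴴ := by
  unfold kr
  rw [conjTranspose_sum]
  refine Finset.sum_congr rfl fun i _ => ?_
  simp [Matrix.mul_assoc]

lemma kr_trace (h : Hom T π) (X : Matrix D D ℂ) : (kr T X).trace = X.trace := by
  unfold kr
  rw [trace_sum]
  calc _ = ∑ i, ((T i)ᴴ * T i * X).trace := Finset.sum_congr rfl fun i _ => by
        rw [trace_mul_comm, Matrix.mul_assoc]
    _ = _ := by rw [← trace_sum, ← Finset.sum_mul, h.iso, Matrix.one_mul]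

lemma Fixd.herm (h : Hom T π) {X : Matrix D D ℂ} (hX : Fixd T π X) : Fixd T π Xᴴ := by
  intro y
  have := congrArg star (hX yᴴ)
  rw [← trace_conjTranspose, ← trace_conjTranspose, conjTranspose_mul, conjTranspose_mul, kr_herm,
    conjTranspose_conjTranspose, ← h.star, conjTranspose_conjTranspose] at this
  rw [trace_mul_comm, this, trace_mul_comm]

lemma expand (h : Hom T π) (ρ y : Matrix D D ℂ) :
    ∑ i, ((π y * T i - T i * y) * ρ * (π y * T i - T i * y)ᴴ).trace =
      (π (yᴴ * y) * kr T ρ).trace - (π y * kr T (ρ * yᴴ)).trace - (π yᴴ * kr T (y * ρ)).trace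
        + (y * ρ * yᴴ).trace := by
  rw [← kr_trace h (y * ρ * yᴴ)]
  have e1 : (π (yᴴ * y) * kr T ρ).trace = (π y * kr T ρ * π yᴴ).trace := by
    rw [h.mul, Matrix.mul_assoc, trace_mul_comm]
  have e2 : (π yᴴ * kr T (y * ρ)).trace = (kr T (y * ρ) * π yᴴ).trace := trace_mul_comm _ _
  rw [e1, e2, h.star]
  unfold kr
  simp only [Finset.mul_sum, Finset.sum_mul, trace_sum, ← Finset.sum_sub_distrib,
    ← Finset.sum_add_distrib]
  refine Finset.sum_congr rfl fun i _ => ?_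
  rw [← trace_sub, ← trace_sub, ← trace_add]
  congr 1
  simp only [conjTranspose_sub, conjTranspose_mul, Matrix.sub_mul, Matrix.mul_sub, Matrix.mul_assoc]
  abel

lemma G_of_expand {ρ y : Matrix D D ℂ} (hρ : ρ.PosSemidef)
    (h : ∑ i, ((π y * T i - T i * y) * ρ * (π y * T i - T i * y)ᴴ).trace = 0) : Gd T π ρ y := by
  intro i
  have := mul_eq_zero_of_trace hρ (fun i => π y * T i - T i * y) h i
  simp only [Matrix.sub_mul] at this
  exact sub_eq_zero.mp this

lemma G_of_fix (h : Hom T π) {ρ y : Matrix D D ℂ} (hρ : ρ.PosSemidef) (hf : Fixd T π ρ)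
    (hy : Fixd T π (y * ρ)) : Gd T π ρ y := by
  refine G_of_expand hρ ?_
  have hy' : Fixd T π (ρ * yᴴ) := by
    have := hy.herm h
    rwa [conjTranspose_mul, hρ.isHermitian.eq] at this
  rw [expand h, hf, hy, hy', Matrix.mul_assoc, trace_mul_comm (y * ρ), ← Matrix.mul_assoc y,
    trace_mul_comm (y * ρ)]
  ring

lemma kr_left {ρ y : Matrix D D ℂ} (g : Gd T π ρ y) : kr T (y * ρ) = π y * kr T ρ := by
  unfold kr
  rw [Finset.mul_sum]
  refine Finset.sum_congr rfl fun i _ => ?_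
  rw [← Matrix.mul_assoc, ← g i]; simp only [Matrix.mul_assoc]

lemma kr_right (h : Hom T π) {ρ y : Matrix D D ℂ} (hρ : ρ.PosSemidef) (g : Gd T π ρ yᴴ) :
    kr T (ρ * y) = kr T ρ * π y := by
  have := congrArg conjTranspose (kr_left g)
  rw [kr_herm, conjTranspose_mul, conjTranspose_mul, kr_herm, conjTranspose_conjTranspose,
    hρ.isHermitian.eq, ← h.star, conjTranspose_conjTranspose] at this
  exact this

lemma fix_right (h : Hom T π) {ρ y : Matrix D D ℂ} (hρ : ρ.PosSemidef) (hf : Fixd T π ρ)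
    (g : Gd T π ρ yᴴ) : Fixd T π (ρ * y) := by
  intro z
  rw [kr_right h hρ g, ← Matrix.mul_assoc, trace_mul_comm, ← Matrix.mul_assoc, ← h.mul, hf,
    Matrix.mul_assoc, trace_mul_comm, Matrix.mul_assoc]

lemma G_star (h : Hom T π) {ρ y w : Matrix D D ℂ} (hρ : ρ.PosSemidef) (hf : Fixd T π ρ)
    (g : Gd T π ρ y) (hw : yᴴ * ρ = ρ * w) : Gd T π ρ yᴴ := by
  refine G_of_expand hρ ?_
  rw [expand h, conjTranspose_conjTranspose]
  have e1 : (π y * kr T (yᴴ * ρ)).trace = (y * (yᴴ * ρ)).trace := by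
    rw [hw]
    unfold kr
    rw [Finset.mul_sum, trace_sum]
    calc _ = ∑ i, ((T i)ᴴ * T i * (y * ρ * w)).trace := Finset.sum_congr rfl fun i _ => by
          have : π y * (T i * (ρ * w) * (T i)ᴴ) = (T i * y * ρ) * w * (T i)ᴴ := by
            rw [← g i]; simp only [Matrix.mul_assoc]
          rw [this, trace_mul_comm]; simp only [Matrix.mul_assoc]
      _ = _ := by rw [← trace_sum, ← Finset.sum_mul, h.iso, Matrix.one_mul, Matrix.mul_assoc]
  have e2 : (π yᴴ * kr T (ρ * y)).trace = (y * (yᴴ * ρ)).trace := by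
    have := congrArg star e1
    rw [← trace_conjTranspose, ← trace_conjTranspose, conjTranspose_mul, kr_herm, ← h.star] at this
    simp only [conjTranspose_mul, conjTranspose_conjTranspose, hρ.isHermitian.eq] at this
    rw [trace_mul_comm, this, Matrix.mul_assoc, trace_mul_comm, Matrix.mul_assoc]
  rw [e1, e2, hf, trace_mul_comm (yᴴ * ρ), Matrix.mul_assoc]
  ring

lemma G_mul (h : Hom T π) {ρ y z w : Matrix D D ℂ} (gy : Gd T π ρ y) (gz : Gd T π ρ z)
    (hw : z * ρ = ρ * w) : Gd T π ρ (y * z) := by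
  intro i
  calc π (y * z) * T i * ρ = π y * (π z * T i * ρ) := by rw [h.mul]; simp only [Matrix.mul_assoc]
    _ = π y * T i * ρ * w := by rw [gz i, Matrix.mul_assoc (T i), hw]; simp only [Matrix.mul_assoc]
    _ = _ := by
      rw [gy i]
      calc T i * y * ρ * w = T i * y * (ρ * w) := by simp only [Matrix.mul_assoc]
        _ = _ := by rw [← hw]; simp only [Matrix.mul_assoc]

/-- Main algebraic identity. -/
lemma pow_identity (h : Hom T π) {ρ X r : Matrix D D ℂ} {s : Matrix O O ℂ} (hρ : ρ.PosSemidef)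
    (hf : Fixd T π ρ) (hX : Fixd T π X) (hXh : Xᴴ = X) (hr : rᴴ = r) (hc : ρ * r = r * ρ)
    (hrr : ρ * r * r = r) (hρρ : ρ * r * ρ = ρ) (hXP : X * (ρ * r) = X)
    (hs : kr T ρ * s = s * kr T ρ) (hss : kr T ρ * s * kr T ρ = kr T ρ) :
    kr T X * (kr T ρ * s) = kr T X ∧
    ∀ k : ℕ, (kr T X ^ (k + 1) * s ^ k).trace = (X ^ (k + 1) * r ^ k).trace := by
  have hρh := hρ.isHermitian.eq
  have hPX : ρ * r * X = X := by
    have := congrArg conjTranspose hXP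
    simp only [conjTranspose_mul, hr, hρh, hXh] at this
    rwa [hc]
  have hXr : X * r * ρ = X := by rw [Matrix.mul_assoc, ← hc, hXP]
  have gY : Gd T π ρ (X * r) := G_of_fix h hρ hf (by rwa [hXr])
  have hYs : (X * r)ᴴ = r * X := by rw [conjTranspose_mul, hr, hXh]
  have hYw : (X * r)ᴴ * ρ = ρ * (r * r * X * ρ) := by
    rw [hYs]
    calc r * X * ρ = (ρ * r * r) * X * ρ := by rw [hrr]
      _ = _ := by simp only [Matrix.mul_assoc]
  have gYs : Gd T π ρ (X * r)ᴴ := G_star h hρ hf gY hYw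
  have kX : kr T X = π (X * r) * kr T ρ := by rw [← kr_left gY, hXr]
  have kX' : kr T X = kr T ρ * π (r * X) := by
    rw [← kr_right h hρ (by rw [← hYs, conjTranspose_conjTranspose]; exact gY), ← Matrix.mul_assoc, hPX]
  have main : ∀ k : ℕ, ρ * (X ^ k * r ^ k) * (r * ρ) = ρ * (X ^ k * r ^ k) ∧
      Gd T π ρ (X ^ k * r ^ k)ᴴ ∧ kr T X ^ k = π (X ^ k * r ^ k) * kr T ρ ^ k := by
    intro k
    induction k with
    | zero =>
      refine ⟨?_, ?_, ?_⟩
      · simp only [pow_zero, Matrix.mul_one]; rw [← Matrix.mul_assoc, hρρ]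
      · intro i; simp [h.one]
      · simp [h.one]
    | succ k ih =>
      obtain ⟨i1, i2, i3⟩ := ih
      set Z := X ^ k * r ^ k with hZ
      have hZ' : X ^ (k + 1) * r ^ (k + 1) = X * Z * r := by
        rw [pow_succ' X, pow_succ r, hZ]; simp only [Matrix.mul_assoc]
      have hZ2 : X * Z * r = (X * r) * (ρ * Z * r) := by
        calc _ = (X * r * ρ) * Z * r := by rw [hXr]
          _ = _ := by simp only [Matrix.mul_assoc]
      have hWρ : ρ * Z * r * ρ = ρ * Z := by rw [Matrix.mul_assoc (ρ * Z), i1]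
      have fW : Fixd T π (ρ * Z * r * ρ) := by rw [hWρ]; exact fix_right h hρ hf i2
      have gW := G_of_fix h hρ hf fW
      have gWs : Gd T π ρ (ρ * Z * r)ᴴ := by
        refine G_star (w := r * r * Zᴴ * ρ * ρ) h hρ hf gW ?_
        rw [conjTranspose_mul, conjTranspose_mul, hr, hρh]
        calc r * (Zᴴ * ρ) * ρ = (ρ * r * r) * (Zᴴ * ρ) * ρ := by rw [hrr]
          _ = _ := by simp only [Matrix.mul_assoc]
      rw [hZ']
      refine ⟨?_, ?_, ?_⟩
      · have : r * (r * ρ) = r := by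
          rw [← hc, ← Matrix.mul_assoc, ← hc, hrr]
        calc _ = ρ * (X * Z * (r * (r * ρ))) := by simp only [Matrix.mul_assoc]
          _ = _ := by rw [this]
      · rw [hZ2, conjTranspose_mul]
        exact G_mul h gWs gYs hYw
      · rw [pow_succ', i3, kX]
        calc _ = π (X * r) * (kr T ρ * π Z) * kr T ρ ^ k := by simp only [Matrix.mul_assoc]
          _ = π (X * r) * (π (ρ * Z * r) * kr T ρ) * kr T ρ ^ k := by
            rw [← kr_right h hρ i2, ← kr_left gW, hWρ]
          _ = _ := by rw [hZ2, h.mul (X * r), pow_succ']; simp only [Matrix.mul_assoc]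
  have hQX : kr T ρ * s * kr T X = kr T X := by
    rw [kX', ← Matrix.mul_assoc, hss]
  have hXQ : kr T X * (kr T ρ * s) = kr T X := by
    rw [kX, hs, Matrix.mul_assoc, ← Matrix.mul_assoc (kr T ρ), hss]
  refine ⟨hXQ, fun k => ?_⟩
  have hpow : ∀ k : ℕ, kr T ρ ^ k * s ^ k * kr T X = kr T X := by
    intro k
    induction k with
    | zero => simp
    | succ k ih =>
      have hcomm : kr T ρ ^ k * s = s * kr T ρ ^ k := ((show Commute (kr T ρ) s from hs).pow_left k)
      calc _ = kr T ρ * (kr T ρ ^ k * s) * s ^ k * kr T X := by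
            rw [pow_succ', pow_succ']; simp only [Matrix.mul_assoc]
        _ = kr T ρ * s * (kr T ρ ^ k * s ^ k * kr T X) := by
            rw [hcomm]; simp only [Matrix.mul_assoc]
        _ = _ := by rw [ih, hQX]
  rw [pow_succ', Matrix.mul_assoc, trace_mul_comm, (main k).2.2]
  rw [Matrix.mul_assoc, Matrix.mul_assoc, ← Matrix.mul_assoc (kr T ρ ^ k), hpow, hX,
    trace_mul_comm, pow_succ' X, Matrix.mul_assoc]

/-- Invariance of the relative entropy. -/
lemma relent_eq (h : Hom T π) {U V : Matrix D D ℂ} {U' V' : Matrix O O ℂ}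
    (hU : Uᴴ * U = 1) (hV : Vᴴ * V = 1) (hU' : U'ᴴ * U' = 1) (hV' : V'ᴴ * V' = 1)
    (f g : D → ℝ) (f' g' : O → ℝ) (hX' : kr T (fnU U f) = fnU U' f')
    (hρ' : kr T (fnU V g) = fnU V' g') (hρ : (fnU V g).PosSemidef)
    (hf : Fixd T π (fnU V g)) (hX : Fixd T π (fnU U f))
    (hs : fnU U f * (fnU V g * fnU V (fun j => (g j)⁻¹)) = fnU U f) :
    ∑ i, f i * Real.logb 2 (f i) - (fnU U f * fnU V (fun j => Real.logb 2 (g j))).trace.re =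
    ∑ i, f' i * Real.logb 2 (f' i) -
      (fnU U' f' * fnU V' (fun j => Real.logb 2 (g' j))).trace.re := by
  have aux : ∀ t : ℝ, t * t⁻¹ * t⁻¹ = t⁻¹ := fun t => by
    by_cases ht : t = 0 <;> simp [ht]
  obtain ⟨p1, p2⟩ := pow_identity (s := fnU V' (fun j => (g' j)⁻¹))
    (r := fnU V (fun j => (g j)⁻¹)) h hρ hf hX (fnU_herm _ _) (fnU_herm _ _)
    (by simp only [fnU_mul hV, mul_comm]) (by simp only [fnU_mul hV, aux])
    (by simp only [fnU_mul hV, mul_inv_mul_cancel]) hs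
    (by rw [hρ']; simp only [fnU_mul hV', mul_comm])
    (by rw [hρ']; simp only [fnU_mul hV', mul_inv_mul_cancel])
  rw [hX', hρ'] at p1
  rw [hX'] at p2
  rw [← relent_sum hU hV f g hs, ← relent_sum hU' hV' f' g' p1]
  refine interp _ _ _ _ (fun k => ?_) _
  have := p2 k
  rw [relent_pow hU hV, relent_pow hU' hV'] at this
  exact_mod_cast this.symm

end core

section concrete
open scoped Kronecker

lemma kraus {b b' : Type*} [Fintype b] [DecidableEq b] [Fintype b'] [DecidableEq b']
    (R : Matrix b b ℂ →ₗ[ℂ] Matrix b' b' ℂ) (hR : IsCPTP R) :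
    ∃ K : (Fin (Fintype.card b) × b') → Matrix b' b ℂ,
      (∀ X, R X = ∑ i, K i * X * (K i)ᴴ) ∧ ∑ i, (K i)ᴴ * K i = 1 := by
  let e := (Fintype.equivFin b).symm
  let w : Fin (Fintype.card b) × b → ℂ := fun p => if e p.1 = p.2 then 1 else 0
  have hM : (vecMulVec w (star w)).PosSemidef := posSemidef_vecMulVec_self_star w
  obtain ⟨S, hS⟩ := psd_factor (hR.2 _ _ hM)
  have hentry : ∀ u v x y, R (single u v 1) x y =
      ∑ i, star (S i (e.symm u, x)) * S i (e.symm v, y) := by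
    intro u v x y
    have := congrFun (congrFun hS (e.symm u, x)) (e.symm v, y)
    rw [Matrix.mul_apply] at this
    simp only [conjTranspose_apply] at this
    rw [← this]
    simp only [tensorId, of_apply]
    have hm : single u v (1 : ℂ) = of fun p q => vecMulVec w (star w) (e.symm u, p) (e.symm v, q) := by
     ext p q
     simp only [of_apply, vecMulVec_apply, w, Pi.star_apply, Equiv.apply_symm_apply, single_apply]
     by_cases h1 : u = p <;> by_cases h2 : v = q <;> simp [h1, h2]
    rw [hm]
  refine ⟨fun i => of fun x u => star (S i (e.symm u, x)), ?_⟩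
  have hK : ∀ X, R X = ∑ i, (of fun x u => star (S i (e.symm u, x)) : Matrix b' b ℂ) * X *
      (of fun x u => star (S i (e.symm u, x)) : Matrix b' b ℂ)ᴴ := by
    intro X
    ext x y
    conv_lhs => rw [matrix_eq_sum_single X]
    simp only [map_sum, Matrix.sum_apply]
    have : ∀ u v, R (single u v (X u v)) x y = X u v * ∑ i, star (S i (e.symm u, x)) * S i (e.symm v, y) := by
      intro u v
      rw [← hentry, ← mul_one (X u v), ← smul_eq_mul, ← smul_single, map_smul]
      simp
    simp only [this, Matrix.mul_apply, conjTranspose_apply, of_apply, star_star, Finset.mul_sum,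
      Finset.sum_mul]
    rw [Finset.sum_comm]
    conv_rhs => rw [Finset.sum_comm]
    refine Finset.sum_congr rfl fun v _ => ?_
    rw [Finset.sum_comm]
    refine Finset.sum_congr rfl fun i _ => Finset.sum_congr rfl fun u _ => ?_
    ring
  refine ⟨hK, ?_⟩
  rw [ext_iff_trace_mul_right]
  intro X
  rw [Matrix.one_mul, ← hR.1 X, hK X, Finset.sum_mul, trace_sum, trace_sum]
  refine Finset.sum_congr rfl fun i _ => ?_
  rw [trace_mul_comm _ (_ᴴ), Matrix.mul_assoc]

variable {A B C : Type*} [Fintype A] [Fintype B] [Fintype C]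
    [DecidableEq A] [DecidableEq B] [DecidableEq C]

/-- `y ↦ y ⊗ 1_C`. -/
def piC (y : Matrix (A × B) (A × B) ℂ) : Matrix (A × B × C) (A × B × C) ℂ :=
  (y ⊗ₖ (1 : Matrix C C ℂ)).submatrix (Equiv.prodAssoc A B C).symm (Equiv.prodAssoc A B C).symm

lemma hom_concrete {ι : Type*} [Fintype ι] (K : ι → Matrix (B × C) B ℂ)
    (hK : ∑ i, (K i)ᴴ * K i = 1) :
    Hom (fun i => (1 : Matrix A A ℂ) ⊗ₖ K i) (piC (A := A) (B := B) (C := C)) where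
  mul x y := by
    unfold piC
    rw [submatrix_mul_equiv, ← mul_kronecker_mul, Matrix.one_mul]
  one := by
    unfold piC
    rw [one_kronecker_one, submatrix_one_equiv]
  star x := by
    unfold piC
    rw [conjTranspose_submatrix, conjTranspose_kronecker, conjTranspose_one]
  iso := by
    have : ∀ i, ((1 : Matrix A A ℂ) ⊗ₖ K i)ᴴ * ((1 : Matrix A A ℂ) ⊗ₖ K i) =
        (1 : Matrix A A ℂ) ⊗ₖ ((K i)ᴴ * K i) := by
      intro i
      rw [conjTranspose_kronecker, conjTranspose_one, ← mul_kronecker_mul, Matrix.one_mul]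
    simp only [this]
    rw [← one_kronecker_one, ← hK]
    ext x y
    simp only [Matrix.sum_apply, kroneckerMap_apply, Finset.mul_sum]

lemma kr_concrete {ι : Type*} [Fintype ι] (K : ι → Matrix (B × C) B ℂ)
    (R : Matrix B B ℂ →ₗ[ℂ] Matrix (B × C) (B × C) ℂ) (hK : ∀ X, R X = ∑ i, K i * X * (K i)ᴴ)
    (X : Matrix (A × B) (A × B) ℂ) :
    kr (fun i => (1 : Matrix A A ℂ) ⊗ₖ K i) X = tensorId (⇑R) X := by
  ext x y
  simp only [kr, tensorId, of_apply, hK, Matrix.sum_apply, Matrix.mul_apply, kroneckerMap_apply,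
    conjTranspose_apply, Fintype.sum_prod_type, Matrix.one_apply]
  refine Finset.sum_congr rfl fun i _ => ?_
  simp [ite_mul, Finset.sum_ite_eq, apply_ite star, mul_ite, Finset.sum_ite_irrel]

lemma trace_piC (y : Matrix (A × B) (A × B) ℂ) (Z : Matrix (A × B × C) (A × B × C) ℂ) :
    (piC y * Z).trace = (y * ptrC3 Z).trace := by
  simp only [Matrix.trace, Matrix.diag, Matrix.mul_apply, piC, ptrC3, of_apply, submatrix_apply,
    kroneckerMap_apply, Fintype.sum_prod_type, Equiv.prodAssoc_symm_apply, Matrix.one_apply,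
    mul_ite, ite_mul, mul_one, mul_zero, zero_mul, Finset.sum_ite_eq, Finset.mem_univ, if_true,
    Finset.mul_sum]
  refine Finset.sum_congr rfl fun a _ => Finset.sum_congr rfl fun b _ => ?_
  rw [Finset.sum_comm]
  refine Finset.sum_congr rfl fun a' _ => ?_
  rw [Finset.sum_comm]

lemma fixd_concrete {ι : Type*} [Fintype ι] (T : ι → Matrix (A × B × C) (A × B) ℂ)
    {X : Matrix (A × B) (A × B) ℂ} (h : ptrC3 (kr T X) = X) : Fixd T piC X := by
  intro y
  rw [trace_piC, h]

lemma trace_one_kron {E F : Type*} [Fintype E] [Fintype F] [DecidableEq E] [DecidableEq F]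
    (X : Matrix (E × F) (E × F) ℂ) (Z : Matrix F F ℂ) :
    (X * ((1 : Matrix E E ℂ) ⊗ₖ Z)).trace = (ptrFst X * Z).trace := by
  simp only [Matrix.trace, Matrix.diag, Matrix.mul_apply, ptrFst, of_apply,
    kroneckerMap_apply, Fintype.sum_prod_type, Matrix.one_apply, Finset.sum_mul,
    mul_ite, ite_mul, one_mul, mul_zero, zero_mul, Finset.sum_ite_irrel, Finset.sum_const_zero,
    Finset.sum_ite_eq', Finset.mem_univ, if_true]
  rw [Finset.sum_comm]
  refine Finset.sum_congr rfl fun a _ => ?_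
  rw [Finset.sum_comm]

lemma fnU_kron {E F : Type*} [Fintype E] [Fintype F] [DecidableEq E] [DecidableEq F]
    (V : Matrix F F ℂ) (g : F → ℝ) :
    (1 : Matrix E E ℂ) ⊗ₖ fnU V g = fnU ((1 : Matrix E E ℂ) ⊗ₖ V) (fun p => g p.2) := by
  unfold fnU
  have : diagonal (fun p : E × F => (g p.2 : ℂ)) = (1 : Matrix E E ℂ) ⊗ₖ diagonal (fun j => (g j : ℂ)) := by
    rw [← diagonal_one, diagonal_kronecker_diagonal]; simp
  rw [this, conjTranspose_kronecker, conjTranspose_one, ← mul_kronecker_mul, ← mul_kronecker_mul]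
  simp

lemma kron_unit {E F : Type*} [Fintype E] [Fintype F] [DecidableEq E] [DecidableEq F]
    {V : Matrix F F ℂ} (hV : Vᴴ * V = 1) :
    ((1 : Matrix E E ℂ) ⊗ₖ V)ᴴ * ((1 : Matrix E E ℂ) ⊗ₖ V) = 1 := by
  rw [conjTranspose_kronecker, conjTranspose_one, ← mul_kronecker_mul, hV, Matrix.one_mul,
    one_kronecker_one]

lemma ptrFst_psd {E F : Type*} [Fintype E] [Fintype F] [DecidableEq E] [DecidableEq F]
    {X : Matrix (E × F) (E × F) ℂ} (h : X.PosSemidef) : (ptrFst X).PosSemidef := by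
  have : ptrFst X = ∑ a, X.submatrix (fun f => (a, f)) (fun f => (a, f)) := by
    ext x y; simp [ptrFst, Matrix.sum_apply]
  rw [this]
  exact posSemidef_sum _ fun a _ => h.submatrix _

lemma vN_eq {n : Type*} [Fintype n] [DecidableEq n] {M : Matrix n n ℂ} (h : M.IsHermitian) :
    vN M = -∑ i, h.eigenvalues i * Real.logb 2 (h.eigenvalues i) := by
  unfold vN
  rw [dif_pos h]
  congr 1
  refine Finset.sum_congr rfl fun i _ => ?_
  unfold xlog
  split_ifs with h0
  · simp [h0]
  · rfl

lemma trace_log {n : Type*} [Fintype n] [DecidableEq n] {M : Matrix n n ℂ} (h : M.IsHermitian) :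
    (M * fnU (h.eigenvectorUnitary : Matrix n n ℂ)
      (fun i => Real.logb 2 (h.eigenvalues i))).trace.re = -vN M := by
  rw [vN_eq h, neg_neg]
  have e : M * fnU (h.eigenvectorUnitary : Matrix n n ℂ) (fun i => Real.logb 2 (h.eigenvalues i)) =
      fnU (h.eigenvectorUnitary : Matrix n n ℂ)
        (fun i => h.eigenvalues i * Real.logb 2 (h.eigenvalues i)) := by
    conv_lhs => enter [1]; rw [spec h]
    exact fnU_mul (spec_unit h) _ _
  rw [e]
  unfold fnU
  rw [trace_mul_comm, ← Matrix.mul_assoc, spec_unit h, Matrix.one_mul, trace_diagonal,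
    Complex.re_sum]
  simp only [Complex.ofReal_re]

lemma supp_kron {E F : Type*} [Fintype E] [Fintype F] [DecidableEq E] [DecidableEq F]
    {X : Matrix (E × F) (E × F) ℂ} (h : X.PosSemidef) {V : Matrix F F ℂ} (hV : Vᴴ * V = 1)
    {g : F → ℝ} (hX : ptrFst X = fnU V g) :
    X * ((1 : Matrix E E ℂ) ⊗ₖ (fnU V g * fnU V (fun j => (g j)⁻¹))) = X := by
  rw [fnU_mul hV]
  set P := (1 : Matrix E E ℂ) ⊗ₖ fnU V (fun j => g j * (g j)⁻¹) with hP
  have hPh : Pᴴ = P := by rw [hP, fnU_kron, fnU_herm]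
  have hPP : P * P = P := by
    rw [hP, ← mul_kronecker_mul, fnU_mul hV, Matrix.one_mul]
    congr 2
    ext j
    by_cases hj : g j = 0 <;> simp [hj]
  have hDD : (1 - P)ᴴ * (1 - P) = 1 - P := by
    rw [conjTranspose_sub, conjTranspose_one, hPh, Matrix.sub_mul, Matrix.mul_sub P, hPP]; simp
  have ht : ((1 - P) * X * (1 - P)ᴴ).trace = 0 := by
    rw [trace_mul_comm, ← Matrix.mul_assoc, hDD, trace_mul_comm, Matrix.mul_sub, trace_sub, hP,
      trace_one_kron, hX, fnU_mul hV, Matrix.mul_one]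
    have e1 : X.trace = (ptrFst X).trace := by
      have := trace_one_kron X 1
      rwa [one_kronecker_one, Matrix.mul_one, Matrix.mul_one] at this
    rw [e1, hX, ← trace_sub]
    have : (fun i => g i * (g i * (g i)⁻¹)) = g := by
      ext j
      by_cases hj : g j = 0 <;> simp [hj]
    rw [this, sub_self, trace_zero]
  have h0 := mul_eq_zero_of_trace h (fun _ : Unit => 1 - P) (by simpa using ht) ()
  have h1 := congrArg conjTranspose h0
  simp only [conjTranspose_mul, conjTranspose_sub, conjTranspose_one, hPh, h.1.eq, Matrix.mul_sub,
    Matrix.mul_one, conjTranspose_zero] at h1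
  exact (sub_eq_zero.mp h1).symm

end concrete

end QIT

open scoped Kronecker in
open QIT Matrix in
theorem markov_aux {A B C : Type*} [Fintype A] [Fintype B] [Fintype C]
    [DecidableEq A] [DecidableEq B] [DecidableEq C]
    (ρAB : Matrix (A × B) (A × B) ℂ) (hρAB : ρAB.PosSemidef)
    (R : Matrix B B ℂ →ₗ[ℂ] Matrix (B × C) (B × C) ℂ) (hR : IsCPTP R)
    (hRO : tensorId (fun M => ptrSnd (R M)) ρAB = ρAB) :
    cmi (tensorId (⇑R) ρAB) = 0 := by
  obtain ⟨K, hK, hK1⟩ := kraus R hR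
  have hH := hom_concrete (A := A) K hK1
  have hkr := kr_concrete (A := A) K R hK
  set T := fun i => (1 : Matrix A A ℂ) ⊗ₖ K i with hT
  have hC3 : ptrC3 (tensorId (⇑R) ρAB) = ρAB := hRO
  have hBC : ptrFst (tensorId (⇑R) ρAB) = R (ptrFst ρAB) := by
    have : ptrFst ρAB = ∑ a, of fun u v => ρAB (a, u) (a, v) := by
      ext x y; simp [ptrFst, Matrix.sum_apply]
    rw [this, map_sum]
    ext x y
    simp [ptrFst, tensorId, Matrix.sum_apply]
  have hB : ptrSnd (R (ptrFst ρAB)) = ptrFst ρAB := by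
    rw [← hBC]
    conv_rhs => rw [← hC3]
    ext x y
    simp only [ptrSnd, ptrFst, ptrC3, of_apply]
    rw [Finset.sum_comm]
  have hρB := ptrFst_psd hρAB
  have hkron : tensorId (⇑R) ((1 : Matrix A A ℂ) ⊗ₖ ptrFst ρAB) =
      (1 : Matrix A A ℂ) ⊗ₖ R (ptrFst ρAB) := by
    ext x y
    simp only [tensorId, of_apply, kroneckerMap_apply]
    have : (of fun u v => (1 : Matrix A A ℂ) x.1 y.1 * ptrFst ρAB u v) =
      (1 : Matrix A A ℂ) x.1 y.1 • ptrFst ρAB := by ext; simp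
    rw [this, map_smul]; simp
  have hσ : (tensorId (⇑R) ρAB).IsHermitian := by
    rw [← hkr]; exact (kr_herm _).trans (by rw [hρAB.1.eq])
  have hσBC : (R (ptrFst ρAB)).IsHermitian := by
    rw [hK]; exact (kr_herm (T := K) _).trans (by rw [hρB.1.eq]; rfl)
  have hfX : Fixd T piC ρAB := fixd_concrete T (by rw [hkr, hC3])
  have hfρ : Fixd T piC ((1 : Matrix A A ℂ) ⊗ₖ ptrFst ρAB) := fixd_concrete T (by
    rw [hkr, hkron]
    conv_rhs => rw [← hB]
    ext x y
    simp [ptrC3, ptrSnd, Finset.mul_sum])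
  have hpsd : ((1 : Matrix A A ℂ) ⊗ₖ ptrFst ρAB).PosSemidef := PosSemidef.one.kronecker hρB
  have eX := spec hρAB.1
  have eB := spec hρB.1
  have eS := spec hσ
  have eBC := spec hσBC
  have eK : (1 : Matrix A A ℂ) ⊗ₖ ptrFst ρAB = _ := (congrArg _ eB).trans (fnU_kron _ _)
  have eK' : (1 : Matrix A A ℂ) ⊗ₖ R (ptrFst ρAB) = _ := (congrArg _ eBC).trans (fnU_kron _ _)
  have hsupp := supp_kron hρAB (spec_unit hρB.1) eB
  have main := relent_eq hH (spec_unit hρAB.1) (kron_unit (E := A) (spec_unit hρB.1)) (spec_unit hσ)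
    (kron_unit (E := A) (spec_unit hσBC)) hρAB.1.eigenvalues (fun p => hρB.1.eigenvalues p.2)
    hσ.eigenvalues (fun p => hσBC.eigenvalues p.2)
    (by rw [← eX, ← eS, hkr]) (by rw [← eK, ← eK', hkr, hkron]) (by rwa [← eK])
    (by rwa [← eK]) (by rwa [← eX])
    (by rw [← eX, ← fnU_kron, ← fnU_kron _ (fun j => (hρB.1.eigenvalues j)⁻¹), ← mul_kronecker_mul,
          Matrix.one_mul, hsupp])
  rw [← eX, ← eS, ← fnU_kron _ (fun j => Real.logb 2 (hρB.1.eigenvalues j)),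
    ← fnU_kron _ (fun j => Real.logb 2 (hσBC.eigenvalues j)), trace_one_kron, trace_one_kron, hBC,
    trace_log, trace_log] at main
  unfold cmi
  rw [hC3, hBC, hB, vN_eq hρAB.1, vN_eq hσ]
  linarith

open QIT in
/-- if the recovery map is "read only" on `B`
(i.e. `(id_A⊗R_{B→B})(ρ_AB) = ρ_AB`), then the output state
`σ_ABC = (id_A⊗R_{B→BC})(ρ_AB)` is a Markov chain `A↔B↔C`. -/
theorem readOnly_recovery_output_is_markov {A B C : Type*} [Fintype A] [Fintype B] [Fintype C]
    [DecidableEq A] [DecidableEq B] [DecidableEq C]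
    (ρAB : Matrix (A × B) (A × B) ℂ) (hρAB : ρAB.PosSemidef) (hρAB1 : ρAB.trace = 1)
    (R : Matrix B B ℂ →ₗ[ℂ] Matrix (B × C) (B × C) ℂ) (hR : IsCPTP R)
    (hRO : tensorId (fun M => ptrSnd (R M)) ρAB = ρAB) :
    cmi (tensorId (⇑R) ρAB) = 0 := by
  exact markov_aux ρAB hρAB R hR hRO
end
end

section
/- For every α ∈ [1/2, ∞), setting p = 1 − 2^{−α} and defining probability distributions on {0,1}×{0,1} by P(0,0) = p and P(x,y) = (1−p)/3 otherwise, Q(1,1) = p and Q(x,y) = (1−p)/3 otherwise, and S(x,y) = 1/4 for all (x,y), one has the strict inequality D(P‖Q) > D(P‖S) + D_α(S‖Q). -/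
noncomputable section

namespace CIT

/-- A probability distribution on a finite set. -/
def IsDist {X : Type*} [Fintype X] (p : X → ℝ) : Prop :=
  (∀ x, 0 ≤ p x) ∧ ∑ x, p x = 1

/-- Support inclusion `supp p ⊆ supp q`. -/
def suppLe {X : Type*} (p q : X → ℝ) : Prop := ∀ x, p x ≠ 0 → q x ≠ 0

open Classical in
/-- Relative entropy (base 2), with `0·log 0 = 0`, `+∞` if the support
condition fails. -/
def relEnt {X : Type*} [Fintype X] (p q : X → ℝ) : EReal :=
  if suppLe p q then ((∑ x, p x * Real.logb 2 (p x / q x) : ℝ) : EReal) else ⊤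

open Classical in
/-- Max-relative entropy `D_max(p‖q) = log max_{x ∈ supp p} p(x)/q(x)`,
`+∞` if the support condition fails. -/
def dMax {X : Type*} [Fintype X] (p q : X → ℝ) : EReal :=
  if suppLe p q then
    ((Real.logb 2 (sSup {r : ℝ | ∃ x, p x ≠ 0 ∧ r = p x / q x}) : ℝ) : EReal)
  else ⊤

open Classical in
/-- Rényi relative entropy of order `α` (base 2), with `D_1 := D` and `+∞`
when `α > 1` and the support condition fails. -/
def renyi {X : Type*} [Fintype X] (α : ℝ) (p q : X → ℝ) : EReal :=
  if α = 1 then relEnt p q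
  else if 1 < α ∧ ¬ suppLe p q then ⊤
  else (((α - 1)⁻¹ * Real.logb 2 (∑ x, p x ^ α * q x ^ (1 - α)) : ℝ) : EReal)

/-- The `XY`-marginal of a tripartite distribution. -/
def margXY {X Y Z : Type*} [Fintype Z] (P : X × Y × Z → ℝ) : X × Y → ℝ :=
  fun t => ∑ z, P (t.1, t.2, z)

/-- The `YZ`-marginal of a tripartite distribution. -/
def margYZ {X Y Z : Type*} [Fintype X] (P : X × Y × Z → ℝ) : Y × Z → ℝ :=
  fun t => ∑ x, P (x, t.1, t.2)

/-- The `Y`-marginal of a tripartite distribution. -/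
def margY {X Y Z : Type*} [Fintype X] [Fintype Z] (P : X × Y × Z → ℝ) : Y → ℝ :=
  fun y => ∑ x, ∑ z, P (x, y, z)

/-- Conditional mutual information
`I(X:Z|Y)_P = Σ P(x,y,z) log( P(x,y,z)·P_Y(y) / (P_XY(x,y)·P_YZ(y,z)) )`. -/
def cmi {X Y Z : Type*} [Fintype X] [Fintype Y] [Fintype Z] (P : X × Y × Z → ℝ) : ℝ :=
  ∑ s : X × Y × Z,
    P s * Real.logb 2 (P s * margY P s.2.1 / (margXY P (s.1, s.2.1) * margYZ P (s.2.1, s.2.2)))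

/-- A classical channel from `Y` to `W`: a family of conditional distributions. -/
def IsChannel {Y W : Type*} [Fintype W] (R : Y → W → ℝ) : Prop :=
  ∀ y, (∀ w, 0 ≤ R y w) ∧ ∑ w, R y w = 1

/-- Action `(id ⊗ R)` of a channel `R : Y → W` on a joint distribution on `X × Y`. -/
def applyChan {X Y W : Type*} [Fintype Y] (R : Y → W → ℝ) (P : X × Y → ℝ) : X × W → ℝ :=
  fun t => ∑ y, P (t.1, y) * R y t.2

/-- Action of a channel `R : Y → W` on a distribution on `Y`. -/
def chanOnDist {Y W : Type*} [Fintype Y] (R : Y → W → ℝ) (q : Y → ℝ) : W → ℝ :=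
  fun w => ∑ y, q y * R y w

/-- Marginal channel `R_{Y→Y}(y'|y) = Σ_{z'} R(y',z'|y)`. -/
def margChan {Y Y' Z' : Type*} [Fintype Z'] (R : Y → Y' × Z' → ℝ) : Y → Y' → ℝ :=
  fun y y' => ∑ z', R y (y', z')

end CIT

lemma aux_conv (n : ℕ) (hn : 0 < n) (y0 y r : ℝ) (h0 : 0 < y0) (hy0 : y0 ≤ y) (hy : y < 1)
    (hr : r ≤ 1 / (n : ℝ)) (h : ((3 + y0) / 4) ^ n < y0) : (3 + y) / 4 < y ^ r := by
  have hypos : 0 < y := by linarith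
  have h1 : ((3 + y) / 4) ^ n < y := by
    have hcv : ConvexOn ℝ (Set.Ici 0) (fun x : ℝ => x ^ n) := convexOn_pow n
    have hc := hcv.2 (show (3 + y0) / 4 ∈ Set.Ici (0 : ℝ) by simp only [Set.mem_Ici]; linarith)
      (show (1 : ℝ) ∈ Set.Ici (0 : ℝ) by simp)
      (show 0 ≤ (1 - y) / (1 - y0) from div_nonneg (by linarith) (by linarith))
      (show 0 ≤ (y - y0) / (1 - y0) from div_nonneg (by linarith) (by linarith))
      (by have : 1 - y0 ≠ 0 := by linarith
          field_simp; ring)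
    have hne : 1 - y0 ≠ 0 := by linarith
    have e1 : ((1 - y) / (1 - y0)) • ((3 + y0) / 4) + ((y - y0) / (1 - y0)) • (1 : ℝ)
        = (3 + y) / 4 := by
      simp only [smul_eq_mul]; field_simp; ring
    rw [e1] at hc
    have e2 : ((1 - y) / (1 - y0)) * y0 + ((y - y0) / (1 - y0)) * 1 = y := by
      field_simp; ring
    have hpos : 0 < (1 - y) / (1 - y0) := div_pos (by linarith) (by linarith)
    have := mul_lt_mul_of_pos_left h hpos
    simp only [smul_eq_mul, one_pow] at hc
    linarith
  have h2 : (3 + y) / 4 < y ^ (1 / (n : ℝ)) := by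
    have h3 := Real.rpow_lt_rpow (z := 1 / (n : ℝ)) (by positivity) h1 (by positivity)
    rwa [one_div, Real.pow_rpow_inv_natCast (by positivity) (by omega), ← one_div] at h3
  exact h2.trans_le (Real.rpow_le_rpow_of_exponent_ge hypos hy.le hr)

lemma aux_log3 : Real.log 3 ≤ 1.1 := by
  rw [Real.log_le_iff_le_exp (by norm_num)]
  have h1 : (3 : ℝ) ^ 10 ≤ (Real.exp 1.1) ^ 10 := by
    rw [← Real.exp_nat_mul]
    have : ((10 : ℕ) : ℝ) * 1.1 = (11 : ℕ) * 1 := by norm_num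
    rw [this, Real.exp_nat_mul]
    calc (3 : ℝ) ^ 10 ≤ (2.718 : ℝ) ^ 11 := by norm_num
      _ ≤ _ := by
        have := Real.exp_one_gt_d9
        exact pow_le_pow_left₀ (by norm_num) (by linarith) _
  exact le_of_pow_le_pow_left₀ (by norm_num) (Real.exp_pos _).le h1

lemma aux_poly (w : ℝ) (hw : 0 ≤ w) :
    (1 + w) * (1.1 + (2 + w) * Real.log 2) ≤ 3.24 * (2 : ℝ) ^ w := by
  have l1 := Real.log_two_gt_d9
  have l2 := Real.log_two_lt_d9
  have h2 : (2 : ℝ) ^ w = Real.exp (Real.log 2 * w) := Real.rpow_def_of_pos (by norm_num) _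
  have h3 : Real.exp (0.6931 * w) ≤ (2 : ℝ) ^ w := by
    rw [h2]; apply Real.exp_le_exp.2; nlinarith
  have h4 := Real.sum_le_exp_of_nonneg (x := 0.6931 * w) (by positivity) 4
  simp only [Finset.sum_range_succ, Finset.sum_range_zero, Nat.factorial] at h4
  norm_num at h4
  have h5 : (1 + w) * (1.1 + (2 + w) * Real.log 2) ≤ (1 + w) * (1.1 + (2 + w) * 0.6932) := by
    gcongr; linarith
  have h6 : (1 + w) * (1.1 + (2 + w) * 0.6932) ≤
      3.24 * (1 + 0.6931 * w + (0.6931 * w) ^ 2 / 2 + (0.6931 * w) ^ 3 / 6) := by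
    nlinarith [mul_nonneg hw (sq_nonneg (w - 1.15)), sq_nonneg (w - 1.15)]
  norm_num at h6 h5 h3 ⊢
  linarith

lemma aux_key (α : ℝ) (hα : 1 < α) (r x : ℝ) (hr : r = (2 : ℝ) ^ (-α) / 3)
    (hx : x = 3 * ((2 : ℝ) ^ α - 1)) :
    (3 + x ^ (1 - α)) / 4 < (x ^ (1 - α)) ^ r := by
  have hA2 : (2 : ℝ) < 2 ^ α := by
    simpa using Real.rpow_lt_rpow_of_exponent_lt (x := 2) (by norm_num) hα
  have hx3 : 3 < x := by rw [hx]; linarith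
  have hy1 : x ^ (1 - α) < 1 := Real.rpow_lt_one_of_one_lt_of_neg (by linarith) (by linarith)
  have hr' : r = 1 / (3 * 2 ^ α) := by
    rw [hr, Real.rpow_neg (by norm_num)]; field_simp
  have hrle : ∀ c : ℝ, 0 < c → c ≤ 3 * 2 ^ α → r ≤ 1 / c := fun c hc h => by
    rw [hr']; exact one_div_le_one_div_of_le hc h
  -- lower bound on y
  have hyl : ∀ X β : ℝ, 1 ≤ X → x ≤ X → α ≤ β → X ^ (1 - β) ≤ x ^ (1 - α) := by
    intro X β hX hxX hβ
    calc X ^ (1 - β) ≤ X ^ (1 - α) := Real.rpow_le_rpow_of_exponent_le hX (by linarith)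
      _ ≤ x ^ (1 - α) := Real.rpow_le_rpow_of_nonpos (by linarith) hxX (by linarith)
  rcases le_or_gt 2 α with h2 | h2
  · have h4 : (4 : ℝ) ≤ 2 ^ α := by
      have := Real.rpow_le_rpow_of_exponent_le (x := 2) (by norm_num) h2
      norm_num at this; exact this
    rcases le_or_gt (1 / 20) (x ^ (1 - α)) with h | h
    · exact aux_conv 12 (by norm_num) (1 / 20) _ r (by norm_num) h hy1
        (by push_cast; exact hrle 12 (by norm_num) (by linarith)) (by norm_num)
    · have hlx : Real.log x ≤ 1.1 + α * Real.log 2 := by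
        have : Real.log x ≤ Real.log (3 * 2 ^ α) := Real.log_le_log (by linarith) (by linarith)
        rw [Real.log_mul (by norm_num) (by positivity), Real.log_rpow (by norm_num)] at this
        linarith [aux_log3]
      have hp := aux_poly (α - 2) (by linarith)
      have e : (2 : ℝ) ^ α = 4 * 2 ^ (α - 2) := by
        rw [Real.rpow_sub (by norm_num)]; norm_num; ring
      have hb : (α - 1) * Real.log x ≤ 0.81 * 2 ^ α := by
        have : (α - 1) * Real.log x ≤ (α - 1) * (1.1 + α * Real.log 2) := by
          apply mul_le_mul_of_nonneg_left hlx (by linarith)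
        have e3 : (1 + (α - 2)) * (1.1 + (2 + (α - 2)) * Real.log 2)
          = (α - 1) * (1.1 + α * Real.log 2) := by ring
        rw [e3] at hp
        rw [e]; linarith
      have hrb : -0.27 ≤ Real.log x * ((1 - α) * r) := by
        have : (α - 1) * Real.log x * r ≤ 0.81 * 2 ^ α * r :=
          mul_le_mul_of_nonneg_right hb (by rw [hr']; positivity)
        have e4 : 0.81 * 2 ^ α * r = 0.27 := by
          rw [hr']; field_simp; norm_num
        nlinarith
      have hexp : (0.7625 : ℝ) ≤ Real.exp (-0.27) := by
        have h0 : (0.973 : ℝ) ≤ Real.exp (-0.027) := by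
          have := Real.add_one_le_exp (-0.027 : ℝ); linarith
        have h0 : (0.9955 : ℝ) ≤ Real.exp (-0.0045) := by
          have := Real.add_one_le_exp (-0.0045 : ℝ); linarith
        have : Real.exp (-0.27) = Real.exp (-0.0045) ^ 60 := by
          rw [← Real.exp_nat_mul]; norm_num
        rw [this]
        calc (0.7625 : ℝ) ≤ 0.9955 ^ 60 := by norm_num
          _ ≤ _ := pow_le_pow_left₀ (by norm_num) h0 _
      rw [← Real.rpow_mul (by linarith), Real.rpow_def_of_pos (x := x) (by linarith) ((1 - α) * r)]
      have := Real.exp_le_exp.2 hrb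
      linarith
  · have h4 : (2 : ℝ) ^ α ≤ 4 := by
      have := Real.rpow_le_rpow_of_exponent_le (x := 2) (by norm_num) h2.le
      norm_num at this; exact this
    have hx9 : x ≤ 9 := by linarith
    have pw : ∀ (a b : ℝ) (n m : ℕ), 0 ≤ a → 0 < b → 0 < n → a ^ n ≤ b ^ m →
        a ≤ b ^ ((m : ℝ) / n) := by
      intro a b n m ha hb hn h
      refine le_of_pow_le_pow_left₀ hn.ne' (by positivity) ?_
      rw [← Real.rpow_natCast (b ^ _), ← Real.rpow_mul hb.le, div_mul_cancel₀ _ (by positivity),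
        Real.rpow_natCast]
      exact h
    rcases le_or_gt α (3 / 2) with h5 | h5
    · have h6 : (2 : ℝ) ^ α ≤ 3 := by
        have h7 := Real.rpow_le_rpow_of_exponent_le (x := 2) (by norm_num) h5
        have h8 : (2 : ℝ) ^ (3 / 2 : ℝ) ≤ 3 := by
          refine le_of_pow_le_pow_left₀ (n := 2) (by norm_num) (by norm_num) ?_
          rw [← Real.rpow_natCast, ← Real.rpow_mul (by norm_num)]; norm_num
        linarith
      have h7 := hyl 6 (3 / 2) (by norm_num) (by linarith) h5
      have h8 := pw 0.34 (1 / 6) 2 1 (by norm_num) (by norm_num) (by norm_num) (by norm_num)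
      have h9 : (6 : ℝ) ^ (1 - 3 / 2 : ℝ) = (1 / 6) ^ (((1 : ℕ) : ℝ) / (2 : ℕ)) := by
        rw [one_div, Real.inv_rpow (by norm_num), ← Real.rpow_neg (by norm_num)]; norm_num
      exact aux_conv 6 (by norm_num) 0.34 _ r (by norm_num) (by linarith) hy1
        (by push_cast; exact hrle 6 (by norm_num) (by linarith)) (by norm_num)
    rcases le_or_gt α (7 / 4) with h6 | h6
    · have h7 := hyl 9 (7 / 4) (by norm_num) (by linarith) h6
      have h8 := pw 0.15 (1 / 9) 4 3 (by norm_num) (by norm_num) (by norm_num) (by norm_num)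
      have h9 : (9 : ℝ) ^ (1 - 7 / 4 : ℝ) = (1 / 9) ^ (((3 : ℕ) : ℝ) / (4 : ℕ)) := by
        rw [one_div, Real.inv_rpow (by norm_num), ← Real.rpow_neg (by norm_num)]; norm_num
      have h10 := pw (8 / 3) 2 2 3 (by norm_num) (by norm_num) (by norm_num) (by norm_num)
      have h11 := Real.rpow_le_rpow_of_exponent_le (x := 2) (by norm_num) h5.le
      norm_num at h10
      exact aux_conv 8 (by norm_num) 0.15 _ r (by norm_num) (by linarith) hy1
        (by push_cast; exact hrle 8 (by norm_num) (by linarith)) (by norm_num)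
    · have h7 := hyl 9 2 (by norm_num) (by linarith) h2.le
      have h9 : (9 : ℝ) ^ (1 - 2 : ℝ) = 1 / 9 := by
        rw [show (1 - 2 : ℝ) = -1 by norm_num, Real.rpow_neg_one]; norm_num
      have h10 := pw (10 / 3) 2 4 7 (by norm_num) (by norm_num) (by norm_num) (by norm_num)
      have h11 := Real.rpow_le_rpow_of_exponent_le (x := 2) (by norm_num) h6.le
      norm_num at h10
      exact aux_conv 10 (by norm_num) (1 / 9) _ r (by norm_num) (h9 ▸ h7) hy1
        (by push_cast; exact hrle 10 (by norm_num) (by linarith)) (by norm_num)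

open CIT in
/-- with `p = 1 - 2^{-α}`, the distributions `P`, `Q`, `S` on
`{0,1}×{0,1}` witness `D(P‖Q) > D(P‖S) + D_α(S‖Q)` for every `α ∈ [1/2, ∞)`. -/
theorem renyi_triangle_strict_violation (α : ℝ) (hα : (1 : ℝ) / 2 ≤ α)
    (p : ℝ) (hp : p = 1 - (2 : ℝ) ^ (-α))
    (P Q S : Fin 2 × Fin 2 → ℝ)
    (hP : P = fun t => if t = ((0 : Fin 2), (0 : Fin 2)) then p else (1 - p) / 3)
    (hQ : Q = fun t => if t = ((1 : Fin 2), (1 : Fin 2)) then p else (1 - p) / 3)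
    (hS : S = fun _ => 1 / 4) :
    relEnt P S + renyi α S Q < relEnt P Q := by
  have hu0 : (0 : ℝ) < 2 ^ (-α) := by positivity
  have hu1 : (2 : ℝ) ^ (-α) < 3 / 4 := by
    have h1 := Real.rpow_le_rpow_of_exponent_le (x := 2) (by norm_num) (neg_le_neg hα)
    have h2 : (2 : ℝ) ^ (-(1 / 2) : ℝ) < 3 / 4 := by
      refine lt_of_pow_lt_pow_left₀ 2 (by norm_num) ?_
      rw [← Real.rpow_natCast, ← Real.rpow_mul (by norm_num)]; norm_num [Real.rpow_neg_one]
    linarith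
  obtain ⟨r, hr⟩ : ∃ r, r = (1 - p) / 3 := ⟨_, rfl⟩
  have hr2 : r = (2 : ℝ) ^ (-α) / 3 := by rw [hr, hp]; ring
  have hpr : p + 3 * r = 1 := by rw [hr]; ring
  have hr0 : 0 < r := by rw [hr2]; positivity
  have hr4 : r < 1 / 4 := by rw [hr2]; linarith
  have hp0 : 0 < p := by linarith
  have hlt : r < p := by linarith
  rw [← hr] at hP hQ
  have sPS : suppLe P S := by intro t _; rw [hS]; norm_num
  have sPQ : suppLe P Q := by
    intro t _; rw [hQ]; dsimp only; split_ifs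
    · exact hp0.ne'
    · exact hr0.ne'
  have sSQ : suppLe S Q := by
    intro t _; rw [hQ]; dsimp only; split_ifs
    · exact hp0.ne'
    · exact hr0.ne'
  have l4 : Real.logb 2 4 = 2 := by
    rw [show (4 : ℝ) = 2 ^ (2 : ℝ) by norm_num]; exact Real.logb_rpow (by norm_num) (by norm_num)
  have l14 : Real.logb 2 (1 / 4) = -2 := by rw [one_div, Real.logb_inv, l4]
  obtain ⟨a, ha⟩ : ∃ a, a = Real.logb 2 p := ⟨_, rfl⟩
  obtain ⟨c, hc⟩ : ∃ c, c = Real.logb 2 r := ⟨_, rfl⟩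
  have hac : c < a := by rw [ha, hc]; exact Real.logb_lt_logb (by norm_num) hr0 hlt
  have E1 : ∑ x, P x * Real.logb 2 (P x / S x) = p * (a + 2) + 3 * r * (c + 2) := by
    simp only [hP, hS, Fintype.sum_prod_type, Fin.sum_univ_two]
    simp only [Prod.mk.injEq, one_ne_zero, and_false, false_and, and_self, if_true, if_false]
    rw [Real.logb_div hp0.ne' (by norm_num), Real.logb_div hr0.ne' (by norm_num), l14, ← ha, ← hc]
    ring
  have E2 : ∑ x, P x * Real.logb 2 (P x / Q x) = p * (a - c) + r * (c - a) := by
    simp only [hP, hQ, Fintype.sum_prod_type, Fin.sum_univ_two]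
    simp only [Prod.mk.injEq, one_ne_zero, zero_ne_one, and_false, false_and, and_self, if_true,
      if_false]
    rw [Real.logb_div hp0.ne' hr0.ne', Real.logb_div hr0.ne' hp0.ne', div_self hr0.ne',
      Real.logb_one, ← ha, ← hc]
    ring
  have F1 : relEnt P S = ((p * (a + 2) + 3 * r * (c + 2) : ℝ) : EReal) := by
    rw [relEnt, if_pos sPS, E1]
  have F2 : relEnt P Q = ((p * (a - c) + r * (c - a) : ℝ) : EReal) := by
    rw [relEnt, if_pos sPQ, E2]
  rw [F1, F2]
  by_cases h1 : α = 1
  · have E3 : ∑ x, S x * Real.logb 2 (S x / Q x) = -2 - 3 / 4 * c - a / 4 := by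
      simp only [hS, hQ, Fintype.sum_prod_type, Fin.sum_univ_two]
      simp only [Prod.mk.injEq, zero_ne_one, and_false, false_and, and_self, if_true, if_false]
      rw [Real.logb_div (by norm_num) hr0.ne', Real.logb_div (by norm_num) hp0.ne', l14, ← ha, ← hc]
      ring
    rw [renyi, if_pos h1, relEnt, if_pos sSQ, E3, ← EReal.coe_add, EReal.coe_lt_coe_iff]
    have : p = 1 - 3 * r := by linarith
    subst this
    nlinarith [mul_pos (sub_pos.2 hac) (sub_pos.2 hr4)]
  · rw [renyi, if_neg h1, if_neg (fun h => h.2 sSQ)]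
    obtain ⟨y, hy⟩ : ∃ y, y = (p / r) ^ (1 - α) := ⟨_, rfl⟩
    have hy0 : 0 < y := by rw [hy]; positivity
    have E3 : ∑ x, S x ^ α * Q x ^ (1 - α)
        = 4 * (1 / 4) ^ α * r ^ (1 - α) * ((3 + y) / 4) := by
      simp only [hS, hQ, Fintype.sum_prod_type, Fin.sum_univ_two]
      simp only [Prod.mk.injEq, zero_ne_one, and_false, false_and, and_self, if_true, if_false]
      have : p ^ (1 - α) = r ^ (1 - α) * y := by
        rw [hy, ← Real.mul_rpow hr0.le (by positivity), mul_div_cancel₀ _ hr0.ne']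
      rw [this]; ring
    obtain ⟨M, hM⟩ : ∃ M, M = Real.logb 2 ((3 + y) / 4) := ⟨_, rfl⟩
    have E4 : Real.logb 2 (∑ x, S x ^ α * Q x ^ (1 - α)) = 2 - 2 * α + (1 - α) * c + M := by
      rw [E3, Real.logb_mul (by positivity) (by positivity),
        Real.logb_mul (by positivity) (by positivity), Real.logb_mul (by positivity) (by positivity),
        Real.logb_rpow_eq_mul_logb_of_pos (by norm_num), Real.logb_rpow_eq_mul_logb_of_pos hr0,
        l4, l14, ← hc, ← hM]
      ring
    have E5 : Real.logb 2 (y ^ r) = r * ((1 - α) * (a - c)) := by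
      rw [Real.logb_rpow_eq_mul_logb_of_pos hy0, hy,
        Real.logb_rpow_eq_mul_logb_of_pos (by positivity), Real.logb_div hp0.ne' hr0.ne', ← ha, ← hc]
    rw [E4, ← EReal.coe_add, EReal.coe_lt_coe_iff]
    have hα1 : α - 1 ≠ 0 := sub_ne_zero.2 h1
    have E6 : (α - 1)⁻¹ * (2 - 2 * α + (1 - α) * c + M) = -2 - c + M / (α - 1) := by
      field_simp; ring
    rw [E6]
    have key : M / (α - 1) < r * (c - a) := by
      rcases lt_or_gt_of_ne h1 with h | h
      · rw [div_lt_iff_of_neg (by linarith)]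
        have hy1 : 1 < y := by
          rw [hy]; exact Real.one_lt_rpow ((one_lt_div hr0).2 hlt) (by linarith)
        have hb := rpow_one_add_le_one_add_mul_self (s := y - 1) (by linarith)
          hr0.le (by linarith : r ≤ 1)
        have hb2 : y ^ r < (3 + y) / 4 := by
          rw [show 1 + (y - 1) = y by ring] at hb
          nlinarith
        have := Real.logb_lt_logb (b := 2) (by norm_num) (by positivity) hb2
        rw [E5, ← hM] at this
        linarith
      · rw [div_lt_iff₀ (by linarith)]
        have hx : p / r = 3 * ((2 : ℝ) ^ α - 1) := by
          rw [hr2, hp, Real.rpow_neg (by norm_num)]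
          field_simp
        have hk := aux_key α h r (p / r) hr2 hx
        rw [← hy] at hk
        have := Real.logb_lt_logb (b := 2) (by norm_num) (by positivity) hk
        rw [E5, ← hM] at this
        linarith
    have : p = 1 - 3 * r := by linarith
    subst this
    nlinarith
end
end

section
/- For every α ∈ [1/2, ∞) there exist finite sets X, Y, Z, a probability distribution P on X×Y×Z, and a classical channel R from Y to Y×Z satisfying R(P_Y) = P_YZ, such that D( P ‖ (id⊗R)(P_XY) ) + Λ_α(P_XY ‖ R_{Y→Y}) < I(X:Z|Y)_P, where R_{Y→Y}(y'|y) = Σ_{z'} R(y',z'|y) is the marginal channel. Hence the max-relative entropy in the Λ-term of the main theorem cannot be replaced by any Rényi relative entropy of finite order α. -/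
noncomputable section

namespace CIT

/-- ratio of the off-diagonal weight to the uniform one -/
def cc (n : ℕ) : ℝ := ((n : ℝ) - 2) / ((n : ℝ) - 1)

/-- the joint distribution of `X` and `Y` -/
def pp (n : ℕ) (x y : Fin n) : ℝ := if x = y then 2 / (n : ℝ) ^ 2 else cc n / (n : ℝ) ^ 2

/-- `Z` is a copy of `X` -/
def PP (n : ℕ) : Fin n × Fin n × Fin n → ℝ := fun s => if s.2.2 = s.1 then pp n s.1 s.2.1 else 0

/-- the recovery channel -/
def RR (n : ℕ) : Fin n → Fin n × Fin n → ℝ :=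
  fun y0 t => if t.2 = y0 then (n : ℝ) * pp n t.2 t.1 else 0

lemma sum_ite_fin (n : ℕ) (y : Fin n) (A B : ℝ) :
    ∑ x : Fin n, (if x = y then A else B) = A + ((n : ℝ) - 1) * B := by
  have h : ∀ x : Fin n, (if x = y then A else B) = (if x = y then A - B else 0) + B := by
    intro x; split_ifs <;> ring
  simp_rw [h]
  rw [Finset.sum_add_distrib]
  simp
  ring

lemma sum_ite_fin2 (n : ℕ) (A B : ℝ) :
    ∑ x : Fin n, ∑ y : Fin n, (if x = y then A else B) = n * (A + ((n : ℝ) - 1) * B) := by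
  have : ∀ x : Fin n, ∑ y : Fin n, (if x = y then A else B) = A + ((n : ℝ) - 1) * B := by
    intro x
    rw [← sum_ite_fin n x A B]
    exact Finset.sum_congr rfl fun y _ => by simp only [eq_comm]
  simp [this]
  ring

lemma cc_pos {n : ℕ} (hn : 5 ≤ n) : 0 < cc n := by
  have : (5 : ℝ) ≤ n := by exact_mod_cast hn
  unfold cc
  apply div_pos <;> linarith

lemma cc_le {n : ℕ} (hn : 5 ≤ n) : cc n ≤ 1 := by
  have : (5 : ℝ) ≤ n := by exact_mod_cast hn
  unfold cc
  rw [div_le_one] <;> linarith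

lemma pp_symm (n : ℕ) (x y : Fin n) : pp n x y = pp n y x := by
  simp only [pp, eq_comm]

lemma pp_pos {n : ℕ} (hn : 5 ≤ n) (x y : Fin n) : 0 < pp n x y := by
  have : (5 : ℝ) ≤ n := by exact_mod_cast hn
  have := cc_pos hn
  unfold pp
  split_ifs <;> positivity

lemma pp_sum {n : ℕ} (hn : 5 ≤ n) (y : Fin n) : ∑ x, pp n x y = 1 / n := by
  have h5 : (5 : ℝ) ≤ n := by exact_mod_cast hn
  have h1 : (n : ℝ) - 1 ≠ 0 := by linarith
  have h0 : (n : ℝ) ≠ 0 := by linarith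
  unfold pp
  rw [sum_ite_fin]
  unfold cc
  field_simp
  ring

lemma pp_sum' {n : ℕ} (hn : 5 ≤ n) (y : Fin n) : ∑ x, pp n y x = 1 / n := by
  rw [← pp_sum hn y]
  exact Finset.sum_congr rfl fun x _ => pp_symm _ _ _

lemma pp_sum2 {n : ℕ} (hn : 5 ≤ n) : ∑ x, ∑ y, pp n x y = 1 := by
  have h5 : (5 : ℝ) ≤ n := by exact_mod_cast hn
  simp_rw [pp_sum' hn]
  have h0 : (n : ℝ) ≠ 0 := by linarith
  simp [h0]

lemma margXY_PP (n : ℕ) : margXY (PP n) = fun t => pp n t.1 t.2 := by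
  funext t; simp [margXY, PP]

lemma margYZ_PP (n : ℕ) : margYZ (PP n) = fun t => pp n t.2 t.1 := by
  funext t; simp [margYZ, PP]

lemma margY_PP {n : ℕ} (hn : 5 ≤ n) : margY (PP n) = fun _ => 1 / (n : ℝ) := by
  funext y
  rw [← pp_sum hn y]
  simp [margY, PP]

lemma apply_RR (n : ℕ) : applyChan (RR n) (margXY (PP n)) =
    fun t => pp n t.1 t.2.2 * (n * pp n t.2.2 t.2.1) := by
  funext t; simp [applyChan, RR, margXY_PP]

lemma isDist_PP {n : ℕ} (hn : 5 ≤ n) : IsDist (PP n) := by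
  constructor
  · intro s
    unfold PP
    split_ifs
    · exact (pp_pos hn _ _).le
    · exact le_rfl
  · rw [Fintype.sum_prod_type]
    simp_rw [Fintype.sum_prod_type]
    rw [← pp_sum2 hn]
    simp [PP]

lemma isChannel_RR {n : ℕ} (hn : 5 ≤ n) : IsChannel (RR n) := by
  have h5 : (5 : ℝ) ≤ n := by exact_mod_cast hn
  have h0 : (n : ℝ) ≠ 0 := by linarith
  intro y
  constructor
  · intro s
    unfold RR
    split_ifs
    · exact mul_nonneg (by linarith) (pp_pos hn _ _).le
    · exact le_rfl
  · rw [Fintype.sum_prod_type]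
    simp only [RR, Finset.sum_ite_eq', Finset.mem_univ, if_true]
    rw [← Finset.mul_sum, pp_sum' hn]
    field_simp

lemma chan_RR {n : ℕ} (hn : 5 ≤ n) : chanOnDist (RR n) (margY (PP n)) = margYZ (PP n) := by
  have h5 : (5 : ℝ) ≤ n := by exact_mod_cast hn
  have h0 : (n : ℝ) ≠ 0 := by linarith
  funext t
  simp [chanOnDist, RR, margY_PP hn, margYZ_PP, h0]

lemma fixed_RR {n : ℕ} (hn : 5 ≤ n) :
    applyChan (X := Fin n) (margChan (RR n)) (fun _ => 1 / (n : ℝ) ^ 2)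
      = fun _ => 1 / (n : ℝ) ^ 2 := by
  have h5 : (5 : ℝ) ≤ n := by exact_mod_cast hn
  have h0 : (n : ℝ) ≠ 0 := by linarith
  funext t
  simp only [applyChan, margChan, RR, Finset.sum_ite_eq', Finset.mem_univ, if_true]
  rw [← Finset.mul_sum, ← Finset.mul_sum, pp_sum hn]
  field_simp

lemma isDist_unif {n : ℕ} (hn : 5 ≤ n) :
    IsDist (fun _ : Fin n × Fin n => 1 / (n : ℝ) ^ 2) := by
  have h5 : (5 : ℝ) ≤ n := by exact_mod_cast hn
  have h0 : (n : ℝ) ≠ 0 := by linarith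
  constructor
  · intro _; positivity
  · simp
    field_simp

lemma relEnt_PP {n : ℕ} (hn : 5 ≤ n) :
    relEnt (PP n) (applyChan (RR n) (margXY (PP n))) = ((Real.logb 2 (n / 2) : ℝ) : EReal) := by
  have h5 : (5 : ℝ) ≤ n := by exact_mod_cast hn
  have h0 : (n : ℝ) ≠ 0 := by linarith
  rw [apply_RR]
  unfold relEnt
  rw [if_pos]
  · congr 1
    rw [Fintype.sum_prod_type]
    simp_rw [Fintype.sum_prod_type]
    have h : ∀ x y z : Fin n, PP n (x, y, z) * Real.logb 2 (PP n (x, y, z) /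
        (pp n x z * (n * pp n z y))) =
        if z = x then pp n x y * Real.logb 2 (n / 2) else 0 := by
      intro x y z
      by_cases hz : z = x
      · subst hz
        have hp := (pp_pos hn z y).ne'
        have : pp n z y / (pp n z z * (n * pp n z y)) = n / 2 := by
          have : pp n z z = 2 / (n : ℝ) ^ 2 := by simp [pp]
          rw [this]; field_simp
        simp [PP, this]
      · simp [PP, hz]
    simp_rw [h]
    simp only [Finset.sum_ite_eq', Finset.mem_univ, if_true]
    simp_rw [← Finset.sum_mul]
    rw [pp_sum2 hn, one_mul]
  · intro s _
    have := pp_pos hn s.1 s.2.2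
    have := pp_pos hn s.2.2 s.2.1
    positivity

lemma cmi_PP {n : ℕ} (hn : 5 ≤ n) :
    Real.logb 2 (n / 2) + ((n : ℝ) - 2) / n ≤ cmi (PP n) := by
  have h5 : (5 : ℝ) ≤ n := by exact_mod_cast hn
  have h0 : (n : ℝ) ≠ 0 := by linarith
  have h1 : (n : ℝ) - 1 ≠ 0 := by linarith
  have hc := cc_pos hn
  have key : cmi (PP n) = n * (2 / (n : ℝ) ^ 2 * Real.logb 2 (n / 2) +
      ((n : ℝ) - 1) * (cc n / (n : ℝ) ^ 2 * Real.logb 2 (n / cc n))) := by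
    rw [← sum_ite_fin2]
    unfold cmi
    rw [Fintype.sum_prod_type]
    simp_rw [Fintype.sum_prod_type]
    refine Finset.sum_congr rfl fun x _ => Finset.sum_congr rfl fun y _ => ?_
    rw [Finset.sum_eq_single x]
    · have hp := (pp_pos hn x y).ne'
      rw [margY_PP hn, margXY_PP, margYZ_PP]
      have e : PP n (x, y, x) = pp n x y := by simp [PP]
      simp only [e]
      have : pp n x y * (1 / (n : ℝ)) / (pp n x y * pp n x y) = 1 / (n * pp n x y) := by
        field_simp
      rw [this]
      unfold pp
      split_ifs
      · congr 2; field_simp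
      · congr 2; field_simp
    · intro z _ hz
      simp [PP, hz]
    · simp
  have hlc : Real.logb 2 (cc n) ≤ 0 :=
    Real.logb_nonpos (by norm_num) hc.le (cc_le hn)
  have e1 : Real.logb 2 (n / cc n) = Real.logb 2 n - Real.logb 2 (cc n) :=
    Real.logb_div h0 hc.ne'
  have e2 : Real.logb 2 ((n : ℝ) / 2) = Real.logb 2 n - 1 := by
    rw [Real.logb_div h0 (by norm_num), Real.logb_self_eq_one (by norm_num)]
  rw [key, e1, e2]
  have e3 : (n : ℝ) * (2 / (n : ℝ) ^ 2 * (Real.logb 2 n - 1) +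
      ((n : ℝ) - 1) * (cc n / (n : ℝ) ^ 2 * (Real.logb 2 n - Real.logb 2 (cc n)))) =
      Real.logb 2 n - 1 + ((n : ℝ) - 2) / n - ((n : ℝ) - 2) / n * Real.logb 2 (cc n) := by
    generalize Real.logb 2 (cc n) = u
    unfold cc
    field_simp
    ring
  rw [e3]
  have : 0 ≤ ((n : ℝ) - 2) / n := div_nonneg (by linarith) (by linarith)
  nlinarith

lemma relEnt_unif {n : ℕ} (hn : 5 ≤ n) :
    ∃ r : ℝ, relEnt (margXY (PP n)) (fun _ => 1 / (n : ℝ) ^ 2) = (r : EReal) ∧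
      r < ((n : ℝ) - 2) / n := by
  have h5 : (5 : ℝ) ≤ n := by exact_mod_cast hn
  have h0 : (n : ℝ) ≠ 0 := by linarith
  have h1 : (n : ℝ) - 1 ≠ 0 := by linarith
  have hc := cc_pos hn
  have hlc : Real.logb 2 (cc n) ≤ 0 :=
    Real.logb_nonpos (by norm_num) hc.le (cc_le hn)
  unfold relEnt
  rw [if_pos]
  · refine ⟨_, rfl, ?_⟩
    rw [margXY_PP, Fintype.sum_prod_type]
    have : ∀ x y : Fin n, pp n x y * Real.logb 2 (pp n x y / (1 / (n : ℝ) ^ 2)) =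
        if x = y then 2 / (n : ℝ) ^ 2 * 1 else cc n / (n : ℝ) ^ 2 * Real.logb 2 (cc n) := by
      intro x y
      unfold pp
      split_ifs
      · congr 1
        have e : (2 : ℝ) / (n : ℝ) ^ 2 / (1 / (n : ℝ) ^ 2) = 2 := by field_simp
        rw [e, Real.logb_self_eq_one (by norm_num)]
      · congr 2; field_simp
    simp_rw [this]
    rw [sum_ite_fin2]
    have e : (n : ℝ) * (2 / (n : ℝ) ^ 2 * 1 +
      ((n : ℝ) - 1) * (cc n / (n : ℝ) ^ 2 * Real.logb 2 (cc n))) =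
      2 / n + ((n : ℝ) - 2) / n * Real.logb 2 (cc n) := by
      generalize Real.logb 2 (cc n) = u
      unfold cc
      field_simp
    rw [e]
    have h2 : 0 ≤ ((n : ℝ) - 2) / n := div_nonneg (by linarith) (by linarith)
    have h3 : 2 / (n : ℝ) < ((n : ℝ) - 2) / n := by
      apply div_lt_div_of_pos_right <;> linarith
    nlinarith
  · intro s _
    positivity

/-- the Rényi sum -/
def SS (α : ℝ) (n : ℕ) : ℝ := 1 / (n : ℝ) * 2 ^ α + (1 - 1 / (n : ℝ)) * cc n ^ α

lemma renyi_unif {n : ℕ} (hn : 5 ≤ n) {α : ℝ} (hα : α ≠ 1) :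
    renyi α (margXY (PP n)) (fun _ => 1 / (n : ℝ) ^ 2)
      = (((α - 1)⁻¹ * Real.logb 2 (SS α n) : ℝ) : EReal) := by
  have h5 : (5 : ℝ) ≤ n := by exact_mod_cast hn
  have hp : (0 : ℝ) < n := by linarith
  have h0 : (n : ℝ) ≠ 0 := by linarith
  have hc := cc_pos hn
  unfold renyi
  rw [if_neg hα, if_neg]
  · congr 3
    rw [margXY_PP, Fintype.sum_prod_type]
    have aux : ∀ u : ℝ, 0 < u →
        (u / (n : ℝ) ^ 2) ^ α * (1 / (n : ℝ) ^ 2) ^ (1 - α) = u ^ α / (n : ℝ) ^ 2 := by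
      intro u hu
      rw [div_eq_mul_one_div u, Real.mul_rpow hu.le (by positivity), mul_assoc,
        ← Real.rpow_add (by positivity)]
      simp
      rfl
    have : ∀ x y : Fin n, pp n x y ^ α * (1 / (n : ℝ) ^ 2) ^ (1 - α) =
        if x = y then 2 ^ α / (n : ℝ) ^ 2 else cc n ^ α / (n : ℝ) ^ 2 := by
      intro x y
      unfold pp
      split_ifs
      · exact aux 2 (by norm_num)
      · exact aux _ hc
    simp_rw [this]
    rw [sum_ite_fin2]
    unfold SS
    field_simp
  · rintro ⟨_, h⟩
    apply h
    intro s _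
    positivity

open Filter Topology in
lemma tendsto_SS (α : ℝ) :
    Tendsto (fun n : ℕ => (α - 1)⁻¹ * Real.logb 2 (SS α n)) atTop (𝓝 0) := by
  have h1 : Tendsto (fun n : ℕ => 1 / (n : ℝ)) atTop (𝓝 0) := tendsto_one_div_atTop_nhds_zero_nat
  have hc : Tendsto cc atTop (𝓝 1) := by
    have : Tendsto (fun n : ℕ => (1 - 2 * (1 / (n : ℝ))) / (1 - 1 / (n : ℝ))) atTop
        (𝓝 ((1 - 2 * 0) / (1 - 0))) :=
      (tendsto_const_nhds.sub (h1.const_mul 2)).div (tendsto_const_nhds.sub h1) (by norm_num)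
    norm_num at this
    refine this.congr' ?_
    filter_upwards [eventually_ge_atTop 5] with n hn
    have h5 : (5 : ℝ) ≤ n := by exact_mod_cast hn
    have h0 : (n : ℝ) ≠ 0 := by linarith
    have h1 : (n : ℝ) - 1 ≠ 0 := by linarith
    unfold cc
    field_simp
  have hS : Tendsto (SS α) atTop (𝓝 (0 * 2 ^ α + (1 - 0) * 1 ^ α)) :=
    (h1.mul_const _).add ((tendsto_const_nhds.sub h1).mul
      (hc.rpow_const (Or.inl one_ne_zero)))
  simp only [zero_mul, sub_zero, one_mul, Real.one_rpow, zero_add] at hS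
  have hl : Tendsto (fun n : ℕ => Real.log (SS α n) / Real.log 2) atTop
      (𝓝 (Real.log 1 / Real.log 2)) := (hS.log one_ne_zero).div_const _
  have := hl.const_mul (α - 1)⁻¹
  simpa [Real.logb] using this

lemma exists_good (α : ℝ) : ∃ n : ℕ, 5 ≤ n ∧ ∃ r : ℝ,
    renyi α (margXY (PP n)) (fun _ => 1 / (n : ℝ) ^ 2) = (r : EReal) ∧
      r < ((n : ℝ) - 2) / n := by
  by_cases hα : α = 1
  · refine ⟨5, le_rfl, ?_⟩
    unfold renyi
    rw [if_pos hα]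
    exact relEnt_unif le_rfl
  · have := ((tendsto_SS α).eventually_lt_const (show (0 : ℝ) < 1 / 2 by norm_num)).and
      (Filter.eventually_ge_atTop 5)
    obtain ⟨n, hlt, hn⟩ := this.exists
    refine ⟨n, hn, _, renyi_unif hn hα, hlt.trans_le ?_⟩
    have h5 : (5 : ℝ) ≤ n := by exact_mod_cast hn
    rw [div_le_div_iff₀ (by norm_num) (by linarith)]
    linarith

end CIT

open CIT in
/-- for every `α ∈ [1/2, ∞)` there are a tripartite
distribution `P` and a channel `R` from `Y` to `Y×Z` with `R(P_Y) = P_YZ` such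
that `D(P ‖ (id⊗R)(P_XY)) + Λ_α(P_XY ‖ R_{Y→Y}) < I(X:Z|Y)_P`. -/
theorem lambda_alpha_term_fails (α : ℝ) (hα : (1 : ℝ) / 2 ≤ α) :
    ∃ (nx ny nz : ℕ) (P : Fin nx × Fin ny × Fin nz → ℝ)
      (R : Fin ny → Fin ny × Fin nz → ℝ),
      IsDist P ∧ IsChannel R ∧ chanOnDist R (margY P) = margYZ P ∧
        relEnt P (applyChan R (margXY P)) +
          (⨅ τ ∈ {τ : Fin nx × Fin ny → ℝ |
              IsDist τ ∧ applyChan (margChan R) τ = τ}, renyi α (margXY P) τ)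
          < ((cmi P : ℝ) : EReal) := by
  obtain ⟨n, hn, r, hr, hlt⟩ := exists_good α
  refine ⟨n, n, n, PP n, RR n, isDist_PP hn, isChannel_RR hn, chan_RR hn, ?_⟩
  rw [relEnt_PP hn]
  have hinf : (⨅ τ ∈ {τ : Fin n × Fin n → ℝ |
      IsDist τ ∧ applyChan (margChan (RR n)) τ = τ}, renyi α (margXY (PP n)) τ) ≤ (r : EReal) := by
    rw [← hr]
    exact iInf₂_le (fun _ => 1 / (n : ℝ) ^ 2) ⟨isDist_unif hn, fixed_RR hn⟩
  refine (add_le_add le_rfl hinf).trans_lt ?_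
  rw [← EReal.coe_add, EReal.coe_lt_coe_iff]
  have := cmi_PP hn
  linarith
end
end
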